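/- Let p be an odd prime, f ∈ Z_p[x] with deg(f) ≥ 2, r ∈ Z, and s ∈ N with s < p. Define R = { n : 0 ≤ n ≤ p−1 and there exists h ∈ {r, r+1, …, r+s−1} with f(n) ≡ h (mod p) } ⊆ Z_p. Then |R| = s + O( deg(f)·p^{1/2}·log p ), and for every positive integer k ≤ deg(f) − 1 one has C_k(R, p) ≤ c·deg(f)·p^{1/2}·(log p)^{k+1} for an absolute constant c > 0. -/

import Mathlib

open Finset Filter

/-- The function `f_R` from the paper: `1 - |R|/q` on `R`, `-|R|/q` off `R`. -/
noncomputable def fsub (q : ℕ) (R : Finset ℕ) (n : ℕ) : ℝ :=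
  if n % q ∈ R then 1 - (R.card : ℝ) / q else -((R.card : ℝ) / q)

/-- The correlation measure `C_k(R,q)` of order `k` of a subset `R ⊆ Z_q`. -/
noncomputable def corrK (R : Finset ℕ) (q k : ℕ) : ℝ :=
  sSup {x : ℝ | ∃ (M : ℕ) (d : Fin k → ℕ), 1 ≤ M ∧ M ≤ q ∧ StrictMono d ∧
    (∀ i, d i ≤ q - 1) ∧ x = |∑ n ∈ Finset.range M, ∏ i, fsub q R (n + d i)|}

/-- `C(R,q,s) = max_{1 ≤ k ≤ s} C_k(R,q)`. -/
noncomputable def corrMeasure (R : Finset ℕ) (q s : ℕ) : ℝ :=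
  sSup {x : ℝ | ∃ k, 1 ≤ k ∧ k ≤ s ∧ x = corrK R q k}

/-- The span of the monomials `x ^ i * y ^ j` of weight `p * i + D * j` less than `W`. -/
def weightFil (F : Type*) {B : Type*} [Field F] [CommRing B] [Algebra F B] (p D : ℕ) (x y : B)
    (W : ℕ) : Submodule F B :=
  Submodule.span F {b | ∃ i j, p * i + D * j < W ∧ b = x ^ i * y ^ j}

section WeightFiltration

open Polynomial

variable {F B : Type*} [Field F] [CommRing B] [Algebra F B] {p D : ℕ} {x y : B}

lemma mem_weightFil {i j W : ℕ} (h : p * i + D * j < W) :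
    x ^ i * y ^ j ∈ weightFil F p D x y W :=
  Submodule.subset_span ⟨i, j, h, rfl⟩

/-- Rewriting `y ^ p` with the curve equation `y ^ p - y = f(x)`. -/
lemma monomial_reduce {f : F[X]} (hxy : y ^ p - y = aeval x f) (i j : ℕ) :
    x ^ i * y ^ (j + p) = x ^ i * y ^ (j + 1) +
      ∑ m ∈ range (f.natDegree + 1), f.coeff m • (x ^ (i + m) * y ^ j) := by
  have h : y ^ p = y + aeval x f := by rw [← hxy]; ring
  rw [pow_add, h, aeval_eq_sum_range, mul_add, mul_add, Finset.mul_sum, Finset.mul_sum]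
  congr 1
  · ring
  · refine Finset.sum_congr rfl fun m _ => ?_
    rw [mul_smul_comm, mul_smul_comm]
    congr 1
    ring

/-- The reduced monomials of weight less than `W` span the filtration step. -/
lemma weightFil_le_span_reduced {f : F[X]} (hp : 2 ≤ p) (hxy : y ^ p - y = aeval x f) (W : ℕ) :
    weightFil F p f.natDegree x y W ≤ Submodule.span F
      ((fun u : ℕ × Fin p => x ^ u.1 * y ^ (u.2 : ℕ)) ''
        {u | p * u.1 + f.natDegree * u.2 < W}) := by
  refine Submodule.span_le.2 ?_
  rintro _ ⟨i, j, h, rfl⟩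
  induction j using Nat.strong_induction_on generalizing i with
  | _ j ih =>
    by_cases hj : j < p
    · exact Submodule.subset_span ⟨(i, ⟨j, hj⟩), h, rfl⟩
    · obtain ⟨j, rfl⟩ := Nat.exists_eq_add_of_le' (not_lt.1 hj)
      have hw : f.natDegree * (j + 1) ≤ f.natDegree * (j + p) :=
        Nat.mul_le_mul_left _ (by omega)
      rw [monomial_reduce hxy]
      refine add_mem (ih _ (by omega) _ (by omega)) (sum_mem fun m hm => ?_)
      refine Submodule.smul_mem _ _ (ih _ (by omega) _ ?_)
      have : p * m ≤ p * f.natDegree :=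
        Nat.mul_le_mul_left _ (by simpa [Nat.lt_succ_iff] using hm)
      nlinarith

/-- Each monomial is, up to lower weight, a nonzero multiple of a reduced one. -/
lemma exists_reduced_sub_mem {f : F[X]} (hp : 2 ≤ p) (hD : 0 < f.natDegree)
    (hxy : y ^ p - y = aeval x f) (i j : ℕ) :
    ∃ c : F, c ≠ 0 ∧ ∃ u : ℕ × Fin p, p * u.1 + f.natDegree * u.2 = p * i + f.natDegree * j ∧
      x ^ i * y ^ j - c • (x ^ u.1 * y ^ (u.2 : ℕ)) ∈
        weightFil F p f.natDegree x y (p * i + f.natDegree * j) := by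
  induction j using Nat.strong_induction_on generalizing i with
  | _ j ih =>
    by_cases hj : j < p
    · exact ⟨1, one_ne_zero, (i, ⟨j, hj⟩), rfl, by simp⟩
    · obtain ⟨j, rfl⟩ := Nat.exists_eq_add_of_le' (not_lt.1 hj)
      obtain ⟨c, hc, u, hu, hmem⟩ := ih j (by omega) (i + f.natDegree)
      have hlc : f.leadingCoeff ≠ 0 := by
        rw [Ne, leadingCoeff_eq_zero]; rintro rfl; simp at hD
      have hW : p * (i + f.natDegree) + f.natDegree * j = p * i + f.natDegree * (j + p) := by ring
      refine ⟨f.leadingCoeff * c, mul_ne_zero hlc hc, u, hu.trans hW, ?_⟩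
      rw [monomial_reduce hxy, Finset.sum_range_succ]
      have : x ^ i * y ^ (j + 1) + (∑ m ∈ range f.natDegree, f.coeff m • (x ^ (i + m) * y ^ j) +
            f.coeff f.natDegree • (x ^ (i + f.natDegree) * y ^ j)) -
            (f.leadingCoeff * c) • (x ^ u.1 * y ^ (u.2 : ℕ)) =
          x ^ i * y ^ (j + 1) + ∑ m ∈ range f.natDegree, f.coeff m • (x ^ (i + m) * y ^ j) +
            f.leadingCoeff • (x ^ (i + f.natDegree) * y ^ j - c • (x ^ u.1 * y ^ (u.2 : ℕ))) := by
        rw [smul_sub, mul_smul, leadingCoeff]; abel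
      rw [this]
      have hlt : f.natDegree * (j + 1) < f.natDegree * (j + p) :=
        Nat.mul_lt_mul_of_pos_left (by omega) hD
      refine add_mem (add_mem (mem_weightFil (by omega)) (sum_mem fun m hm => ?_))
        (Submodule.smul_mem _ _ (hW ▸ hmem))
      refine Submodule.smul_mem _ _ (mem_weightFil ?_)
      have : p * m < p * f.natDegree := Nat.mul_lt_mul_of_pos_left (by simpa using hm) (by omega)
      nlinarith

lemma weight_injective (hp : 0 < p) (hcop : p.Coprime D) :
    Function.Injective fun u : ℕ × Fin p => p * u.1 + D * (u.2 : ℕ) := by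
  rintro ⟨i, j⟩ ⟨i', j'⟩ h
  simp only at h
  have h1 : D * (j : ℕ) ≡ D * j' [MOD p] := by
    have := congrArg (· % p) h
    simpa [Nat.ModEq, Nat.add_mod] using this
  have h2 : (j : ℕ) = j' :=
    Nat.ModEq.eq_of_lt_of_lt (Nat.ModEq.cancel_left_of_coprime hcop h1) j.2 j'.2
  rw [h2, add_left_inj] at h
  exact Prod.ext (Nat.eq_of_mul_eq_mul_left hp h) (Fin.ext h2)

lemma finrank_weightFil_le {f : F[X]} (hp : 2 ≤ p) (hcop : p.Coprime f.natDegree)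
    (hxy : y ^ p - y = aeval x f) (W : ℕ) :
    Module.Finite F (weightFil F p f.natDegree x y W) ∧
      Module.finrank F (weightFil F p f.natDegree x y W) ≤ W := by
  set S : Set (ℕ × Fin p) := {u | p * u.1 + f.natDegree * u.2 < W}
  have hmaps : Set.MapsTo (fun u : ℕ × Fin p => p * u.1 + f.natDegree * (u.2 : ℕ)) S
      (Set.Iio W) := fun u hu => hu
  have hinj := (weight_injective (p := p) (by omega) hcop).injOn (s := S)
  have hfin : S.Finite := Set.Finite.of_injOn hmaps hinj (Set.finite_Iio W)
  have hcard : S.ncard ≤ W := by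
    simpa using Set.ncard_le_ncard_of_injOn _ hmaps hinj (Set.finite_Iio W)
  set V := Submodule.span F ((fun u : ℕ × Fin p => x ^ u.1 * y ^ (u.2 : ℕ)) '' S)
  have hV : weightFil F p f.natDegree x y W ≤ V := weightFil_le_span_reduced hp hxy W
  have himg := hfin.image (fun u : ℕ × Fin p => x ^ u.1 * y ^ (u.2 : ℕ))
  have _ : Module.Finite F V := Module.Finite.span_of_finite F himg
  refine ⟨Submodule.finiteDimensional_of_le hV, (Submodule.finrank_mono hV).trans ?_⟩
  have _ := himg.fintype
  refine (finrank_span_le_card _).trans ?_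
  rw [← Set.ncard_eq_toFinset_card']
  exact (Set.ncard_image_le hfin).trans hcard

/-- Monomials of pairwise distinct weights are linearly independent. -/
lemma eq_zero_of_sum_monomial_eq_zero {f : F[X]} (hp : 2 ≤ p)
    (hD : 0 < f.natDegree) (hxy : y ^ p - y = aeval x f)
    (hind : LinearIndependent F fun u : ℕ × Fin p => x ^ u.1 * y ^ (u.2 : ℕ))
    {T : Type*} [Fintype T] (a b : T → ℕ)
    (hinj : Function.Injective fun t => p * a t + f.natDegree * b t)
    (c : T → F) (hc : ∑ t, c t • (x ^ a t * y ^ b t) = 0) : c = 0 := by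
  classical
  by_contra hne
  obtain ⟨t0, ht0⟩ := Function.ne_iff.1 hne
  obtain ⟨t, ht, hmax⟩ := (univ.filter fun t => c t ≠ 0).exists_max_image
    (fun t => p * a t + f.natDegree * b t) ⟨t0, by simpa using ht0⟩
  have htc : c t ≠ 0 := by simpa using ht
  set W := p * a t + f.natDegree * b t with hW
  have hmem : x ^ a t * y ^ b t ∈ weightFil F p f.natDegree x y W := by
    rw [← Finset.add_sum_erase _ _ (mem_univ t)] at hc
    have : x ^ a t * y ^ b t = -(c t)⁻¹ • ∑ s ∈ univ.erase t, c s • (x ^ a s * y ^ b s) := by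
      rw [eq_neg_of_add_eq_zero_right hc, neg_smul, smul_neg, neg_neg, smul_smul,
        inv_mul_cancel₀ htc, one_smul]
    rw [this]
    refine Submodule.smul_mem _ _ (sum_mem fun s hs => ?_)
    by_cases hcs : c s = 0
    · simp [hcs]
    · refine Submodule.smul_mem _ _ (mem_weightFil ?_)
      refine lt_of_le_of_ne (hmax s (by simpa using hcs)) ?_
      exact fun h => (mem_erase.1 hs).1 (hinj h)
  obtain ⟨e, he, u, hu, hsub⟩ := exists_reduced_sub_mem hp hD hxy (a t) (b t)
  have h1 : x ^ u.1 * y ^ (u.2 : ℕ) ∈ weightFil F p f.natDegree x y W := by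
    have := Submodule.smul_mem _ e⁻¹ (sub_mem hmem hsub)
    rwa [sub_sub_cancel, smul_smul, inv_mul_cancel₀ he, one_smul] at this
  refine hind.notMem_span_image (s := {u | p * u.1 + f.natDegree * u.2 < W}) (x := u) ?_
    (weightFil_le_span_reduced hp hxy W h1)
  simp [hu, hW]

/-- Every large weight is attained by a monomial. -/
lemma exists_weight_eq (hp : 0 < p) (hcop : p.Coprime D) {W : ℕ} (hW : p * D ≤ W) :
    ∃ i j, p * i + D * j = W := by
  obtain ⟨j, -, hj⟩ := Nat.exists_mul_mod_eq_of_coprime W hcop.symm hp.ne'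
  have hjm : D * (j % p) ≡ W [MOD p] := ((Nat.mod_modEq j p).mul_left D).trans hj
  have hle : D * (j % p) ≤ W :=
    (Nat.mul_le_mul_left D (Nat.mod_lt j hp).le).trans (by rwa [mul_comm])
  obtain ⟨i, hi⟩ := (Nat.modEq_iff_dvd' hle).1 hjm
  exact ⟨i, j % p, by omega⟩

end WeightFiltration

section ArtinSchreier

lemma pow_card_pow_artinSchreier {p : ℕ} [Fact p.Prime] {K : Type*} [Field K] [CharP K p]
    {z w : K} (h : z ^ p - z = w) (n : ℕ) :
    z ^ p ^ n = z + ∑ i ∈ range n, w ^ p ^ i := by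
  induction n with
  | zero => simp
  | succ n ih =>
    have : z ^ p = z + w := by rw [← h]; ring
    rw [pow_succ', pow_mul, this, add_pow_char_pow, ih, Finset.sum_range_succ, add_assoc]

open Polynomial

variable {p : ℕ} [hp : Fact p.Prime] {K : Type} [Field K] [Algebra (ZMod p) K]

/-- The coordinate ring of the affine Artin–Schreier curve `y ^ p - y = f(x)`. -/
lemma exists_artinSchreier_ring (K : Type) [Field K] [Algebra (ZMod p) K] (f : (ZMod p)[X]) :
    ∃ (B : Type) (_ : CommRing B) (_ : Algebra (ZMod p) B) (x y : B),
      y ^ p - y = aeval x f ∧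
      (LinearIndependent (ZMod p) fun u : ℕ × Fin p => x ^ u.1 * y ^ (u.2 : ℕ)) ∧
      ∀ x₀ y₀ : K, y₀ ^ p - y₀ = aeval x₀ f → ∃ φ : B →ₐ[ZMod p] K, φ x = x₀ ∧ φ y = y₀ := by
  have h2 := hp.out.two_le
  set g : (ZMod p)[X][X] := X ^ p - (X + C f) with hg
  have hdeg : (X + C f : (ZMod p)[X][X]).degree < p := by
    rw [degree_X_add_C]; exact_mod_cast h2
  have hmon : g.Monic := monic_X_pow_sub hdeg
  have hgdeg : g.degree = p := by
    rw [hg, degree_sub_eq_left_of_degree_lt] <;> rw [degree_X_pow]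
    exact hdeg
  refine ⟨AdjoinRoot g, inferInstance, inferInstance, AdjoinRoot.of g X, AdjoinRoot.root g,
    ?_, ?_, ?_⟩
  · have h := AdjoinRoot.eval₂_root g
    simp only [hg, eval₂_sub, eval₂_add, eval₂_pow, eval₂_X, eval₂_C] at h
    have h3 : aeval (AdjoinRoot.of g X) f = AdjoinRoot.of g f := by
      have := Polynomial.aeval_algHom_apply
        (IsScalarTower.toAlgHom (ZMod p) (ZMod p)[X] (AdjoinRoot g)) X f
      simpa using this
    rw [h3]
    linear_combination h
  · refine LinearIndependent.of_comp ((AdjoinRoot.modByMonicHom hmon).restrictScalars (ZMod p)) ?_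
    have hcomp : (((AdjoinRoot.modByMonicHom hmon).restrictScalars (ZMod p)) ∘
        fun u : ℕ × Fin p => AdjoinRoot.of g X ^ u.1 * AdjoinRoot.root g ^ (u.2 : ℕ)) =
        fun u => C (X ^ u.1) * X ^ (u.2 : ℕ) := by
      funext u
      have : AdjoinRoot.of g X ^ u.1 * AdjoinRoot.root g ^ (u.2 : ℕ) =
          AdjoinRoot.mk g (C (X ^ u.1) * X ^ (u.2 : ℕ)) := by simp
      simp only [Function.comp_apply, LinearMap.coe_restrictScalars]
      rw [this, AdjoinRoot.modByMonicHom_mk, modByMonic_eq_self_iff hmon, hgdeg]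
      refine (degree_C_mul_X_pow_le _ _).trans_lt ?_
      exact_mod_cast u.2.2
    rw [hcomp, linearIndependent_iff']
    intro s c hc u hu
    have := congrArg (fun q : (ZMod p)[X][X] => (q.coeff u.2).coeff u.1) hc
    simp only [finsetSum_coeff, coeff_smul, coeff_C_mul, coeff_X_pow, coeff_zero] at this
    rw [Finset.sum_eq_single_of_mem u hu] at this
    · simpa using this
    · rintro v - hv
      by_cases h1 : (u.2 : ℕ) = v.2
      · have : u.1 ≠ v.1 := fun h => hv (Prod.ext h.symm (Fin.ext h1.symm))
        simp [h1, coeff_X_pow, this]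
      · simp [h1]
  · intro x₀ y₀ h
    have h0 : eval₂ ((aeval x₀ : (ZMod p)[X] →ₐ[ZMod p] K) : (ZMod p)[X] →+* K) y₀ g = 0 := by
      simp only [hg, eval₂_sub, eval₂_add, eval₂_pow, eval₂_X, eval₂_C]
      rw [← sub_sub, h]; simp
    refine ⟨{ AdjoinRoot.lift _ y₀ h0 with commutes' := fun r => ?_ }, ?_, ?_⟩
    · have : algebraMap (ZMod p) (AdjoinRoot g) r = AdjoinRoot.of g (C r) := rfl
      simp [this]
    · change AdjoinRoot.lift _ y₀ h0 _ = _
      simp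
    · change AdjoinRoot.lift _ y₀ h0 _ = _
      simp

/-- If a polynomial of `y`-degree less than `p` vanishes at all points of the curve above the
points of `Z`, then `Z` is small. -/
lemma card_le_of_forall_vanish [IsAlgClosed K] (f : (ZMod p)[X]) (Z : Finset K)
    (h : (ℕ × Fin p) →₀ ZMod p) (hne : h ≠ 0) {N : ℕ} (hN : ∀ u ∈ h.support, p * u.1 ≤ N)
    (hz : ∀ x₀ ∈ Z, ∀ y₀ : K, y₀ ^ p - y₀ = aeval x₀ f →
      h.sum (fun u c => algebraMap (ZMod p) K c * (x₀ ^ u.1 * y₀ ^ (u.2 : ℕ))) = 0) :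
    p * Z.card ≤ N := by
  classical
  have _ : CharP K p := charP_of_injective_algebraMap (algebraMap (ZMod p) K).injective p
  have h0 := hp.out.pos
  obtain ⟨u₀, hu₀⟩ := Finsupp.support_nonempty_iff.2 hne
  set s := h.support.filter fun u => u.2 = u₀.2 with hs
  set q : (ZMod p)[X] := ∑ u ∈ s, monomial u.1 (h u) with hq
  have hu₀s : u₀ ∈ s := by simp [hs, hu₀]
  have hq0 : q ≠ 0 := by
    intro hq0
    have := congrArg (fun r => coeff r u₀.1) hq0
    simp only [hq, finsetSum_coeff, coeff_monomial, coeff_zero] at this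
    rw [Finset.sum_eq_single_of_mem u₀ hu₀s] at this
    · simp at this; simp [this] at hu₀
    · intro v hv hvne
      rw [if_neg]
      exact fun hh => hvne (Prod.ext hh (mem_filter.1 hv).2)
  have hdeg : p * q.natDegree ≤ N := by
    have : q.natDegree ≤ N / p := by
      refine natDegree_sum_le_of_forall_le _ _ fun u hu => ?_
      refine (natDegree_monomial_le _).trans ?_
      rw [Nat.le_div_iff_mul_le h0, mul_comm]
      exact hN u (mem_filter.1 hu).1
    calc p * q.natDegree ≤ p * (N / p) := Nat.mul_le_mul_left _ this
      _ ≤ N := Nat.mul_div_le _ _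
  refine (Nat.mul_le_mul_left _ ?_).trans hdeg
  have hmap0 : q.map (algebraMap (ZMod p) K) ≠ 0 :=
    (Polynomial.map_ne_zero_iff (algebraMap (ZMod p) K).injective).2 hq0
  rw [← natDegree_map (algebraMap (ZMod p) K)]
  refine Polynomial.card_le_degree_of_subset_roots ?_
  intro x₀ hx₀
  rw [mem_roots hmap0, IsRoot.def, eval_map_algebraMap]
  obtain ⟨y₀, hy₀⟩ : ∃ y₀ : K, y₀ ^ p - y₀ = aeval x₀ f := by
    have h2 := hp.out.two_le
    have hd : (X + C (aeval x₀ f) : K[X]).degree < p := by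
      rw [degree_X_add_C]; exact_mod_cast h2
    have : (X ^ p - (X + C (aeval x₀ f)) : K[X]).degree ≠ 0 := by
      rw [degree_sub_eq_left_of_degree_lt] <;> rw [degree_X_pow]
      · exact_mod_cast h0.ne'
      · exact hd
    obtain ⟨y, hy⟩ := IsAlgClosed.exists_root _ this
    refine ⟨y, ?_⟩
    simp at hy
    linear_combination hy
  set H : K[X] := ∑ u ∈ h.support,
    monomial (u.2 : ℕ) (algebraMap (ZMod p) K (h u) * x₀ ^ u.1) with hH
  have hH0 : H = 0 := by
    refine eq_zero_of_natDegree_lt_card_of_eval_eq_zero H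
      (f := fun c : ZMod p => y₀ + algebraMap (ZMod p) K c)
      (fun a b hab => (algebraMap (ZMod p) K).injective (add_left_cancel hab)) ?_ ?_
    · intro c
      have := hz x₀ hx₀ (y₀ + algebraMap (ZMod p) K c) (by
        rw [add_pow_char, ← map_pow, ZMod.pow_card, ← hy₀]; ring)
      rw [Finsupp.sum] at this
      rw [hH, eval_finsetSum, ← this]
      refine Finset.sum_congr rfl fun u _ => ?_
      rw [eval_monomial]; ring
    · rw [ZMod.card]
      refine lt_of_le_of_lt (b := p - 1) ?_ (by omega)
      refine natDegree_sum_le_of_forall_le _ _ fun u _ => (natDegree_monomial_le _).trans ?_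
      have := u.2.2
      omega
  have := congrArg (fun r => coeff r u₀.2) hH0
  simp only [hH, finsetSum_coeff, coeff_monomial, coeff_zero, ← Finset.sum_filter] at this
  rw [hq, map_sum, ← this]
  refine Finset.sum_congr ?_ fun u _ => by rw [aeval_monomial]
  ext u; simp [hs, Fin.ext_iff]

end ArtinSchreier

section Stepanov

open Polynomial

variable {p : ℕ} [hp : Fact p.Prime] {K : Type} [Field K] [Algebra (ZMod p) K]

lemma card_trace_fiber_le_aux [IsAlgClosed K] (f : (ZMod p)[X]) (hD : 0 < f.natDegree)
    (hcop : p.Coprime f.natDegree) {e μ g : ℕ} (hμ : μ ≤ e) (hg : g = p * f.natDegree)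
    (hbig : g ^ 2 + 3 * g + 1 < p ^ e) (α : ZMod p) (Z : Finset K)
    (hZ : ∀ x₀ ∈ Z, x₀ ^ p ^ (e + μ) = x₀ ∧
      ∑ i ∈ range (e + μ), (aeval x₀ f) ^ p ^ i = algebraMap (ZMod p) K α) :
    p * Z.card ≤ p ^ (e + μ) + (2 * g + 1) * p ^ e := by
  classical
  have _ : CharP K p := charP_of_injective_algebraMap (algebraMap (ZMod p) K).injective p
  have h2 := hp.out.two_le
  obtain ⟨B, _, _, x, y, hxy, hind, hlift⟩ := exists_artinSchreier_ring K f
  have _ : Nontrivial B := ⟨_, _, (hind.ne_zero (0, ⟨0, hp.out.pos⟩))⟩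
  have _ : CharP B p := charP_of_injective_algebraMap (algebraMap (ZMod p) B).injective p
  set D := f.natDegree
  set P := p ^ e with hP
  set Q := p ^ μ with hQ
  have hQP : Q ≤ P := Nat.pow_le_pow_right hp.out.pos hμ
  have hPQ : p ^ (e + μ) = P * Q := pow_add _ _ _
  set m := Q + 2 * g with hm
  have hw : ∀ W, ∃ ij : ℕ × ℕ, g ≤ W → p * ij.1 + D * ij.2 = W := fun W => by
    by_cases h : g ≤ W
    · obtain ⟨i, j, hij⟩ := exists_weight_eq hp.out.pos hcop (hg ▸ h)
      exact ⟨(i, j), fun _ => hij⟩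
    · exact ⟨(0, 0), fun h' => absurd h' h⟩
  choose ij hij using hw
  let T := (Finset.Icc g (P - 1) ×ˢ Finset.Icc g m : Finset (ℕ × ℕ))
  have hT1 : ∀ t : T, p * (ij t.1.1).1 + D * (ij t.1.1).2 = t.1.1 := fun t =>
    hij _ (mem_Icc.1 (mem_product.1 t.2).1).1
  have hT2 : ∀ t : T, p * (ij t.1.2).1 + D * (ij t.1.2).2 = t.1.2 := fun t =>
    hij _ (mem_Icc.1 (mem_product.1 t.2).2).1
  have hT3 : ∀ t : T, t.1.1 < P := fun t => by
    have := (mem_Icc.1 (mem_product.1 t.2).1).2; omega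
  have hT4 : ∀ t : T, t.1.2 ≤ m := fun t => (mem_Icc.1 (mem_product.1 t.2).2).2
  -- the reduction map `δ`
  set v : T → B := fun t => (x ^ (ij t.1.1).1 * y ^ (ij t.1.1).2) ^ Q *
    (x ^ (ij t.1.2).1 * (y + algebraMap (ZMod p) B α) ^ (ij t.1.2).2) with hv
  set N := (P - 1) * Q + m + 1 with hN
  have hvmem : ∀ t, v t ∈ weightFil (ZMod p) p D x y N := by
    intro t
    simp only [hv]
    rw [add_pow, Finset.mul_sum, Finset.mul_sum]
    refine sum_mem fun k hk => ?_
    have : (x ^ (ij t.1.1).1 * y ^ (ij t.1.1).2) ^ Q * (x ^ (ij t.1.2).1 *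
        (y ^ k * algebraMap (ZMod p) B α ^ ((ij t.1.2).2 - k) * ((ij t.1.2).2.choose k : B))) =
        (α ^ ((ij t.1.2).2 - k) * ((ij t.1.2).2.choose k : ZMod p)) •
        (x ^ (Q * (ij t.1.1).1 + (ij t.1.2).1) * y ^ (Q * (ij t.1.1).2 + k)) := by
      rw [Algebra.smul_def, map_mul, map_pow, map_natCast]; ring
    rw [this]
    refine Submodule.smul_mem _ _ (mem_weightFil ?_)
    have h1 : Q * t.1.1 ≤ Q * (P - 1) := Nat.mul_le_mul_left _ (by have := hT3 t; omega)
    have h3 : D * k ≤ D * (ij t.1.2).2 :=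
      Nat.mul_le_mul_left _ (by simpa [Nat.lt_succ_iff] using hk)
    have h4 := hT4 t
    have h5 := hT2 t
    rw [← hT1 t] at h1
    rw [hN]
    nlinarith
  obtain ⟨hfin, hrank⟩ := finrank_weightFil_le h2 hcop hxy N
  set δ : (T → ZMod p) →ₗ[ZMod p] weightFil (ZMod p) p D x y N :=
    (Fintype.linearCombination (ZMod p) v).codRestrict _ (fun c => by
      rw [Fintype.linearCombination_apply]
      exact sum_mem fun t _ => Submodule.smul_mem _ _ (hvmem t)) with hδ
  have hker : LinearMap.ker δ ≠ ⊥ := by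
    refine LinearMap.ker_ne_bot_of_finrank_lt (hrank.trans_lt ?_)
    rw [Module.finrank_fintype_fun_eq_card, Fintype.card_coe, card_product, Nat.card_Icc,
      Nat.card_Icc, hN, hm]
    obtain ⟨P', hP'⟩ : ∃ P', P = P' + g + 1 := ⟨P - g - 1, by
      have : g + 1 ≤ P := by nlinarith
      omega⟩
    rw [show P - 1 + 1 - g = P' + 1 by omega, show Q + 2 * g + 1 - g = Q + g + 1 by omega,
      show P - 1 = P' + g by omega]
    nlinarith
  obtain ⟨c, hcker, hc0⟩ := (Submodule.ne_bot_iff _).1 hker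
  have hδc : ∑ t, c t • v t = 0 := by
    have := congrArg Subtype.val (LinearMap.mem_ker.1 hcker)
    simpa [hδ, Fintype.linearCombination_apply] using this
  -- the auxiliary function
  set a : T → ℕ := fun t => (ij t.1.1).1 + P * (ij t.1.2).1 with ha
  set b : T → ℕ := fun t => (ij t.1.1).2 + P * (ij t.1.2).2 with hb
  have hab : ∀ t, p * a t + D * b t = t.1.1 + P * t.1.2 := fun t => by
    calc p * a t + D * b t = (p * (ij t.1.1).1 + D * (ij t.1.1).2) +
          P * (p * (ij t.1.2).1 + D * (ij t.1.2).2) := by simp only [ha, hb]; ring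
      _ = t.1.1 + P * t.1.2 := by rw [hT1, hT2]
  set w : B := ∑ t, c t • (x ^ a t * y ^ b t) with hw
  have hw0 : w ≠ 0 := by
    intro hw0
    refine hc0 (eq_zero_of_sum_monomial_eq_zero h2 hD hxy hind a b ?_ c hw0)
    intro s t hst
    simp only at hst
    rw [hab, hab] at hst
    have e1 : s.1.1 = t.1.1 := by
      have := congrArg (· % P) hst
      simpa [Nat.add_mul_mod_self_left, Nat.mod_eq_of_lt (hT3 _)] using this
    rw [e1, add_right_inj] at hst
    exact Subtype.ext (Prod.ext e1 (Nat.eq_of_mul_eq_mul_left (by omega) hst))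
  have hwmem : w ∈ weightFil (ZMod p) p D x y (P - 1 + P * m + 1) := by
    refine sum_mem fun t _ => Submodule.smul_mem _ _ (mem_weightFil ?_)
    rw [hab]
    have := hT3 t
    have := Nat.mul_le_mul_left P (hT4 t)
    omega
  obtain ⟨h, hsupp, hhw⟩ := (Finsupp.mem_span_image_iff_linearCombination _).1
    (weightFil_le_span_reduced h2 hxy _ hwmem)
  have hbound : p * Z.card ≤ P - 1 + P * m := by
    refine card_le_of_forall_vanish f Z h ?_ (N := P - 1 + P * m) ?_ ?_
    · rintro rfl
      exact hw0 (by rw [← hhw, map_zero])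
    · intro u hu
      have : p * u.1 + D * (u.2 : ℕ) < P - 1 + P * m + 1 := hsupp hu
      omega
    · intro x₀ hx₀ y₀ hy₀
      obtain ⟨hx1, hx2⟩ := hZ x₀ hx₀
      obtain ⟨φ, hφx, hφy⟩ := hlift x₀ y₀ hy₀
      have hy1 : y₀ ^ (P * Q) = y₀ + algebraMap (ZMod p) K α := by
        rw [← hPQ, pow_card_pow_artinSchreier hy₀, hx2]
      rw [hPQ] at hx1
      have hφw : φ w = 0 := by
        have : φ w ^ Q = φ (∑ t, c t • v t) := by
          rw [hw, map_sum, map_sum, hQ, sum_pow_char_pow, ← hQ]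
          refine Finset.sum_congr rfl fun t _ => ?_
          have key : φ (x ^ a t * y ^ b t) ^ Q = φ (v t) := by
            simp only [hv, ha, hb, map_mul, map_pow, map_add, AlgHom.commutes, hφx, hφy]
            rw [← hy1]
            calc _ = (x₀ ^ (ij t.1.1).1 * y₀ ^ (ij t.1.1).2) ^ Q *
                  ((x₀ ^ (P * Q)) ^ (ij t.1.2).1 * (y₀ ^ (P * Q)) ^ (ij t.1.2).2) := by ring
              _ = _ := by rw [hx1]
          rw [map_smul, map_smul, _root_.smul_pow, key, hQ, ZMod.pow_card_pow]
        rw [hδc, map_zero] at this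
        exact pow_eq_zero_iff (pow_pos hp.out.pos _).ne' |>.1 this
      rw [← hφw, ← hhw, Finsupp.linearCombination_apply, Finsupp.sum, Finsupp.sum, map_sum]
      refine Finset.sum_congr rfl fun u _ => ?_
      rw [Algebra.smul_def, map_mul, AlgHom.commutes, map_mul, map_pow, map_pow, hφx, hφy]
  rw [hPQ]
  calc p * Z.card ≤ P - 1 + P * m := hbound
    _ ≤ P + P * m := by omega
    _ = P * Q + (2 * g + 1) * P := by rw [hm]; ring

end Stepanov

open Polynomial in
/-- The subfield of `p ^ n` elements, as a finite set. -/
noncomputable def frobFixed (p : ℕ) (K : Type) [Field K] [DecidableEq K] (n : ℕ) : Finset K :=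
  (X ^ p ^ n - X : K[X]).roots.toFinset

section Stepanov

open Polynomial

lemma mem_frobFixed {p : ℕ} [hp : Fact p.Prime] {K : Type} [Field K] [DecidableEq K] {n : ℕ}
    (hn : n ≠ 0) {x : K} : x ∈ frobFixed p K n ↔ x ^ p ^ n = x := by
  have := FiniteField.X_pow_card_pow_sub_X_ne_zero K hn hp.out.one_lt
  simp [frobFixed, mem_roots this, sub_eq_zero]

variable {p : ℕ} [hp : Fact p.Prime] {K : Type} [Field K] [DecidableEq K] [Algebra (ZMod p) K]

lemma card_frobFixed [IsAlgClosed K] {n : ℕ} (hn : n ≠ 0) : (frobFixed p K n).card = p ^ n := by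
  have _ : CharP K p := charP_of_injective_algebraMap (algebraMap (ZMod p) K).injective p
  have hsep : (X ^ p ^ n - X : K[X]).Separable :=
    galois_poly_separable p (p ^ n) (dvd_pow_self p hn)
  rw [frobFixed, Multiset.toFinset_card_of_nodup (nodup_roots hsep),
    ← (IsAlgClosed.splits (X ^ p ^ n - X : K[X])).natDegree_eq_card_roots,
    FiniteField.X_pow_card_pow_sub_X_natDegree_eq K hn hp.out.one_lt]

lemma norm_sum_trace_le [IsAlgClosed K] (f : (ZMod p)[X]) (hD : 0 < f.natDegree)
    (hcop : p.Coprime f.natDegree) {ψ : AddChar (ZMod p) ℂ} (hψ : ψ ≠ 1) :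
    ∃ C : ℝ, ∀ n : ℕ, n ≠ 0 → ∀ τ : K → ZMod p,
      (∀ x ∈ frobFixed p K n,
        algebraMap (ZMod p) K (τ x) = ∑ i ∈ range n, (aeval x f) ^ p ^ i) →
      ‖∑ x ∈ frobFixed p K n, ψ (τ x)‖ ≤ C * √p ^ n := by
  set g := p * f.natDegree with hg
  have hp1 : (1 : ℝ) ≤ √p := Real.one_le_sqrt.2 (by exact_mod_cast hp.out.one_le)
  have hsq : √(p : ℝ) ^ 2 = p := Real.sq_sqrt (by positivity)
  refine ⟨(2 * g + 1) * √p + (g ^ 2 + 3 * g + 1) ^ 2, fun n hn τ hτ => ?_⟩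
  set e := n - n / 2
  have hen : e + n / 2 = n := by omega
  have hcard := card_frobFixed (p := p) (K := K) hn
  by_cases hbig : g ^ 2 + 3 * g + 1 < p ^ e
  · have hfib : ∀ a, p * ((frobFixed p K n).filter fun x => τ x = a).card ≤
        p ^ n + (2 * g + 1) * p ^ e := by
      intro a
      have := card_trace_fiber_le_aux (K := K) f hD hcop (e := e) (μ := n / 2) (by omega) hg hbig a
        ((frobFixed p K n).filter fun x => τ x = a) ?_
      · rwa [hen] at this
      · intro x hx
        rw [hen]
        obtain ⟨h1, h2⟩ := mem_filter.1 hx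
        exact ⟨(mem_frobFixed hn).1 h1, by rw [← hτ x h1, h2]⟩
    have hp0 : (0 : ℝ) < p := by exact_mod_cast hp.out.pos
    have hsum : ∑ x ∈ frobFixed p K n, ψ (τ x) =
        ∑ a, (((((frobFixed p K n).filter fun x => τ x = a).card : ℝ) -
          (p ^ n + (2 * g + 1) * p ^ e) / p : ℝ) : ℂ) * ψ a := by
      push_cast
      simp only [sub_mul, Finset.sum_sub_distrib]
      rw [← Finset.mul_sum, AddChar.sum_eq_zero_of_ne_one hψ, mul_zero, sub_zero,
        ← Finset.sum_fiberwise_of_maps_to (t := univ) (g := τ) (fun _ _ => mem_univ _)]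
      refine Finset.sum_congr rfl fun a _ => ?_
      rw [Finset.sum_congr rfl (g := fun _ => ψ a) (fun x hx => by rw [(mem_filter.1 hx).2])]
      simp
    have hN : ∑ a, (((frobFixed p K n).filter fun x => τ x = a).card : ℝ) = p ^ n := by
      have := Finset.card_eq_sum_card_fiberwise (f := τ) (s := frobFixed p K n) (t := univ)
        (fun _ _ => mem_univ _)
      rw [hcard] at this
      exact_mod_cast this.symm
    have hE : ‖∑ x ∈ frobFixed p K n, ψ (τ x)‖ ≤ (2 * g + 1) * p ^ e := by
      rw [hsum]
      refine (norm_sum_le _ _).trans ?_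
      have : ∀ a ∈ univ, ‖(((((frobFixed p K n).filter fun x => τ x = a).card : ℝ) -
          (p ^ n + (2 * g + 1) * p ^ e) / p : ℝ) : ℂ) * ψ a‖ ≤
          (p ^ n + (2 * g + 1) * p ^ e) / p -
            (((frobFixed p K n).filter fun x => τ x = a).card : ℝ) := by
        intro a _
        rw [norm_mul, AddChar.norm_apply, mul_one, Complex.norm_real, Real.norm_eq_abs,
          abs_sub_comm, abs_of_nonneg]
        rw [sub_nonneg, le_div_iff₀ hp0, mul_comm]
        exact_mod_cast hfib a
      refine (Finset.sum_le_sum this).trans (le_of_eq ?_)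
      rw [Finset.sum_sub_distrib, hN, Finset.sum_const, card_univ, ZMod.card, nsmul_eq_mul]
      field_simp
      ring
    have hpe : (p : ℝ) ^ e ≤ √p * √p ^ n := by
      calc (p : ℝ) ^ e = √p ^ (2 * e) := by rw [pow_mul, hsq]
        _ ≤ √p ^ (n + 1) := pow_le_pow_right₀ hp1 (by omega)
        _ = √p * √p ^ n := pow_succ' _ _
    calc _ ≤ (2 * g + 1) * (p : ℝ) ^ e := hE
      _ ≤ (2 * g + 1) * (√p * √p ^ n) := by gcongr
      _ ≤ _ := by
        rw [add_mul, mul_assoc]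
        have : 0 ≤ ((g : ℝ) ^ 2 + 3 * g + 1) ^ 2 * √p ^ n := by positivity
        linarith
  · have h1 : ‖∑ x ∈ frobFixed p K n, ψ (τ x)‖ ≤ p ^ n := by
      refine (norm_sum_le _ _).trans ?_
      simp [hcard]
    have h2 : p ^ n ≤ (g ^ 2 + 3 * g + 1) ^ 2 :=
      calc p ^ n ≤ p ^ (e * 2) := Nat.pow_le_pow_right hp.out.pos (by omega)
        _ = (p ^ e) ^ 2 := pow_mul _ _ _
        _ ≤ _ := Nat.pow_le_pow_left (not_lt.1 hbig) 2
    have h3 : (p : ℝ) ^ n ≤ (g ^ 2 + 3 * g + 1) ^ 2 := by exact_mod_cast h2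
    refine h1.trans (h3.trans ?_)
    have h4 : 1 ≤ √(p : ℝ) ^ n := one_le_pow₀ hp1
    have h5 : 0 ≤ ((2 * g + 1) * √p : ℝ) := by positivity
    nlinarith [sq_nonneg ((g : ℝ) ^ 2 + 3 * g + 1)]

end Stepanov

section PowerSums

open Polynomial

lemma reverse_prod_X_sub_C {K : Type*} [Field K] (s : Multiset K) :
    (s.map fun α => X - C α).prod.reverse = (s.map fun α => 1 - C α * X).prod := by
  induction s using Multiset.induction_on with
  | empty => simpa using reverse_C (1 : K)
  | cons α s ih =>
    have h : (X - C α : K[X]).reverse = 1 - C α * X := by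
      rw [reverse, natDegree_X_sub_C, reflect_sub, reflect_C, pow_one]
      simp
    rw [Multiset.map_cons, Multiset.map_cons, Multiset.prod_cons, Multiset.prod_cons,
      reverse_mul_of_domain, ih, h]

/-- Newton's identities in generating function form. -/
lemma derivative_prod_one_sub {K : Type*} [Field K] (s : Multiset K) :
    PowerSeries.derivative K (((s.map fun α => 1 - C α * X).prod : K[X]) : PowerSeries K) =
      -((((s.map fun α => 1 - C α * X).prod : K[X]) : PowerSeries K) *
        PowerSeries.mk fun k => (s.map fun α => α ^ (k + 1)).sum) := by
  induction s using Multiset.induction_on with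
  | empty =>
    have : (PowerSeries.mk fun _ => (0 : K)) = 0 := rfl
    simp [this]
  | cons α s ih =>
    have hsplit : (PowerSeries.mk fun k => ((α ::ₘ s).map fun α => α ^ (k + 1)).sum) =
        (PowerSeries.mk fun k => α ^ (k + 1)) +
          PowerSeries.mk fun k => (s.map fun α => α ^ (k + 1)).sum := by
      ext k; simp
    have hgeom : ((1 - C α * X : K[X]) : PowerSeries K) *
        (PowerSeries.mk fun k => α ^ (k + 1)) = PowerSeries.C α := by
      ext k
      cases k with
      | zero => simp [sub_mul, mul_assoc]
      | succ k => simp [sub_mul, mul_assoc, PowerSeries.coeff_succ_X_mul]; ring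
    have hder : PowerSeries.derivative K ((1 - C α * X : K[X]) : PowerSeries K) =
        -PowerSeries.C α := by
      rw [PowerSeries.derivative_coe]
      simp
    rw [Multiset.map_cons, Multiset.prod_cons, Polynomial.coe_mul, Derivation.leibniz, ih, hder,
      hsplit, ← hgeom]
    simp only [smul_eq_mul]
    ring

/-- The effect on power sums of perturbing a single coefficient. -/
lemma sum_map_pow_add_shift {K : Type*} [Field K] {g h : K[X]} (hg : g.Monic) (hh : h.Monic)
    (hgs : g.Splits) (hhs : h.Splits) {D : ℕ} (hD : 0 < D) {b : K}
    (hrev : h.reverse = g.reverse + C b * X ^ D) {j : ℕ} (hj : 0 < j) (hjD : j ≤ D) :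
    (h.roots.map (· ^ j)).sum = (g.roots.map (· ^ j)).sum - if j = D then D * b else 0 := by
  have key : ∀ q : K[X], q.Monic → q.Splits → PowerSeries.derivative K (q.reverse : PowerSeries K) =
      -((q.reverse : PowerSeries K) * PowerSeries.mk fun k => (q.roots.map (· ^ (k + 1))).sum) := by
    intro q hq hqs
    have h1 : q = (q.roots.map fun α => X - C α).prod := hqs.eq_prod_roots_of_monic hq
    have h2 : q.reverse = (q.roots.map fun α => 1 - C α * X).prod := by
      conv_lhs => rw [h1]
      exact reverse_prod_X_sub_C _
    rw [h2]
    exact derivative_prod_one_sub _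
  have e1 := key g hg hgs
  have e2 := key h hh hhs
  set V := PowerSeries.mk fun k => (g.roots.map (· ^ (k + 1))).sum with hV
  set W := PowerSeries.mk fun k => (h.roots.map (· ^ (k + 1))).sum with hW
  set u : PowerSeries K := (h.reverse : PowerSeries K) with hu
  have hu0 : PowerSeries.constantCoeff u ≠ 0 := by
    rw [hu, ← PowerSeries.coeff_zero_eq_constantCoeff_apply, coeff_coe, coeff_zero_reverse, hh]
    exact one_ne_zero
  have hu1 : PowerSeries.constantCoeff u⁻¹ = 1 := by
    rw [PowerSeries.constantCoeff_inv, hu, ← PowerSeries.coeff_zero_eq_constantCoeff_apply,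
      coeff_coe, coeff_zero_reverse, hh, inv_one]
  have hrev' : (g.reverse : PowerSeries K) = u - PowerSeries.C b * PowerSeries.X ^ D := by
    rw [hu, hrev]; simp
  have hdX : PowerSeries.derivative K (PowerSeries.C b * PowerSeries.X ^ D) =
      PowerSeries.C (D * b) * PowerSeries.X ^ (D - 1) := by
    ext k
    rw [PowerSeries.coeff_derivative]
    simp only [PowerSeries.coeff_C_mul, PowerSeries.coeff_X_pow]
    by_cases hk : k + 1 = D
    · subst hk; simp; ring
    · rw [if_neg hk, if_neg (by omega)]; simp
  rw [hrev', map_sub, hdX, e2] at e1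
  obtain ⟨E, rfl⟩ : ∃ E, D = E + 1 := ⟨D - 1, by omega⟩
  have hWV : W = V - PowerSeries.X ^ E * (u⁻¹ * PowerSeries.C b *
      (PowerSeries.C ((E + 1 : ℕ) : K) + PowerSeries.X * V)) := by
    have hinv := PowerSeries.mul_inv_cancel u hu0
    have : u * (W - V) = - (PowerSeries.X ^ E * (PowerSeries.C b *
      (PowerSeries.C ((E + 1 : ℕ) : K) + PowerSeries.X * V))) := by
      rw [Nat.add_sub_cancel, map_mul] at e1
      linear_combination (-1 : PowerSeries K) * e1
    have h2 := congrArg (u⁻¹ * ·) this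
    beta_reduce at h2
    linear_combination h2 - (W - V) * hinv
  obtain ⟨i, rfl⟩ : ∃ i, j = i + 1 := ⟨j - 1, by omega⟩
  have := congrArg (PowerSeries.coeff i) hWV
  rw [map_sub, PowerSeries.coeff_X_pow_mul', hW, hV, PowerSeries.coeff_mk, PowerSeries.coeff_mk]
    at this
  rw [this]
  congr 1
  by_cases hi : i = E
  · subst hi
    simp [hu1]
    ring
  · rw [if_neg (by omega), if_neg (by omega)]

end PowerSums

section RootSum

open Polynomial

variable {F K : Type*} [Field F] [Field K] [Algebra F K]

/-- The sum of the values of `f` at the roots of `g`, counted with multiplicity. -/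
noncomputable def rootSum (K : Type*) [Field K] [Algebra F K] (f g : F[X]) : K :=
  ((g.aroots K).map fun α => aeval α f).sum

lemma rootSum_mul (f : F[X]) {g h : F[X]} (hg : g ≠ 0) (hh : h ≠ 0) :
    rootSum K f (g * h) = rootSum K f g + rootSum K f h := by
  simp [rootSum, aroots_mul (mul_ne_zero hg hh)]

lemma rootSum_one (f : F[X]) : rootSum K f 1 = 0 := by simp [rootSum]

lemma rootSum_X_add_C (f : F[X]) (a : F) :
    rootSum K f (X + C a) = algebraMap F K (f.eval (-a)) := by
  have := aroots_X_sub_C (S := K) (-a)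
  rw [map_neg, sub_neg_eq_add] at this
  rw [rootSum, this, Multiset.map_singleton, Multiset.sum_singleton,
    aeval_algebraMap_apply_eq_algebraMap_eval]

lemma rootSum_add_C_mul_X_pow [IsAlgClosed K] (f : F[X]) (hD : 0 < f.natDegree) {g : F[X]}
    (hg : g.Monic) (hgD : f.natDegree ≤ g.natDegree) (b : F) :
    rootSum K f (g + C b * X ^ (g.natDegree - f.natDegree)) =
      rootSum K f g - algebraMap F K (f.natDegree * b * f.leadingCoeff) := by
  set D := f.natDegree with hDdef
  set h := g + C b * X ^ (g.natDegree - D) with hdef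
  have hlt : (C b * X ^ (g.natDegree - D)).degree < g.degree := by
    rw [degree_eq_natDegree hg.ne_zero]
    refine (degree_C_mul_X_pow_le _ _).trans_lt ?_
    exact_mod_cast (by omega : g.natDegree - D < g.natDegree)
  have hh : h.Monic := hg.add_of_left hlt
  have hdeg : h.natDegree = g.natDegree := natDegree_add_eq_left_of_degree_lt hlt
  have hrev : (h.map (algebraMap F K)).reverse =
      (g.map (algebraMap F K)).reverse + C (algebraMap F K b) * X ^ D := by
    rw [reverse, reverse, natDegree_map, natDegree_map, hdeg, hdef, Polynomial.map_add, reflect_add]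
    congr 1
    rw [Polynomial.map_mul, Polynomial.map_pow, map_X, map_C, reflect_C_mul_X_pow,
      revAt_le (by omega)]
    congr 2
    omega
  have hpow : ∀ j, j ≤ D → ((h.aroots K).map (· ^ j)).sum =
      ((g.aroots K).map (· ^ j)).sum - if j = D then D * algebraMap F K b else 0 := by
    intro j hj
    rcases Nat.eq_zero_or_pos j with rfl | hj0
    · have hc : ∀ q : F[X], (q.aroots K).card = q.natDegree := fun q => by
        rw [aroots_def, ← (IsAlgClosed.splits _).natDegree_eq_card_roots, natDegree_map]
      simp only [pow_zero, Multiset.map_const', Multiset.sum_replicate, hc, hdeg]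
      rw [if_neg (by omega), sub_zero]
    · exact sum_map_pow_add_shift (hg.map _) (hh.map _) (IsAlgClosed.splits _)
        (IsAlgClosed.splits _) hD hrev hj0 hj
  have hexp : ∀ q : F[X], rootSum K f q = ∑ j ∈ range (D + 1),
      algebraMap F K (f.coeff j) * ((q.aroots K).map (· ^ j)).sum := by
    intro q
    rw [rootSum]
    simp_rw [← Multiset.sum_map_mul_left, aeval_eq_sum_range, Algebra.smul_def]
    rw [← hDdef]
    generalize q.aroots K = s
    induction s using Multiset.induction_on with
    | empty => simp
    | cons α s ih => simp only [Multiset.map_cons, Multiset.sum_cons, ih, sum_add_distrib]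
  rw [hexp, hexp, sum_range_succ, sum_range_succ, hpow D le_rfl, if_pos rfl,
    Finset.sum_congr rfl fun j hj => by
      rw [hpow j (mem_range.1 hj).le, if_neg (mem_range.1 hj).ne, sub_zero]]
  simp only [leadingCoeff, ← hDdef, map_mul, map_natCast]
  ring

end RootSum

section Frobenius

open Polynomial

variable {p : ℕ} [hp : Fact p.Prime] {K : Type} [Field K] [Algebra (ZMod p) K]

lemma isIntegral_of_mem_frobFixed [DecidableEq K] {n : ℕ} (hn : n ≠ 0) {x : K}
    (hx : x ∈ frobFixed p K n) : IsIntegral (ZMod p) x := by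
  refine IsAlgebraic.isIntegral ⟨X ^ p ^ n - X,
    FiniteField.X_pow_card_pow_sub_X_ne_zero _ hn hp.out.one_lt, ?_⟩
  simp [(mem_frobFixed hn).1 hx]

lemma natDegree_minpoly_dvd_iff {x : K} (hx : IsIntegral (ZMod p) x) {i : ℕ} :
    (minpoly (ZMod p) x).natDegree ∣ i ↔ x ^ p ^ i = x := by
  rw [(minpoly.irreducible hx).natDegree_dvd_iff_dvd_X_pow_card_pow_sub_X, Nat.card_zmod,
    minpoly.dvd_iff]
  simp [sub_eq_zero]

lemma aeval_pow_prime_pow (f : (ZMod p)[X]) (x : K) (i : ℕ) :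
    aeval (x ^ p ^ i) f = aeval x f ^ p ^ i := by
  induction i with
  | zero => simp
  | succ i ih => rw [pow_succ, pow_mul, ← expand_aeval, ZMod.expand_card, map_pow, ih, ← pow_mul]

/-- `x ^ p ^ i`, `i < n`, runs `n / m` times through the roots of the minimal polynomial. -/
lemma nsmul_rootSum_minpoly [DecidableEq K] [IsAlgClosed K] (f : (ZMod p)[X]) {n : ℕ}
    (hn : n ≠ 0) {x : K} (hx : x ∈ frobFixed p K n) :
    (minpoly (ZMod p) x).natDegree ∣ n ∧
    (n / (minpoly (ZMod p) x).natDegree) • rootSum K f (minpoly (ZMod p) x) =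
      ∑ i ∈ range n, (aeval x f) ^ p ^ i := by
  have _ : CharP K p := charP_of_injective_algebraMap (algebraMap (ZMod p) K).injective p
  set P := minpoly (ZMod p) x with hP
  set m := P.natDegree with hm
  have hxint : IsIntegral (ZMod p) x := isIntegral_of_mem_frobFixed hn hx
  have hirr : Irreducible P := minpoly.irreducible hxint
  have hm0 : 0 < m := minpoly.natDegree_pos hxint
  have hdvd : ∀ i, m ∣ i ↔ x ^ p ^ i = x := fun i => natDegree_minpoly_dvd_iff hxint
  have hroot : ∀ i, aeval (x ^ p ^ i) P = 0 := by
    intro i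
    rw [aeval_pow_prime_pow, minpoly.aeval, zero_pow (pow_ne_zero _ hp.out.ne_zero)]
  have hsep : (P.map (algebraMap (ZMod p) K)).Separable :=
    (PerfectField.separable_of_irreducible hirr).map
  have hnodup : (P.aroots K).Nodup := nodup_roots hsep
  have hinj : Set.InjOn (fun i => x ^ p ^ i) (range m) := by
    have haux : ∀ i j, i < j → j < m → x ^ p ^ i ≠ x ^ p ^ j := by
      intro i j hij hjm heq
      have h1 : (x ^ p ^ (j - i)) ^ p ^ i = x ^ p ^ i := by
        rw [← pow_mul, ← pow_add, Nat.sub_add_cancel hij.le, heq]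
      have h2 := (hdvd (j - i)).2 (iterateFrobenius_inj K p i h1)
      exact absurd (Nat.le_of_dvd (by omega) h2) (by omega)
    intro i hi j hj hij
    rw [coe_range, Set.mem_Iio] at hi hj
    by_contra hne
    rcases Nat.lt_or_gt_of_ne hne with h | h
    · exact haux i j h hj hij
    · exact haux j i h hi hij.symm
  have himg : (range m).image (fun i => x ^ p ^ i) = (P.aroots K).toFinset := by
    apply eq_of_subset_of_card_le
    · intro y hy
      obtain ⟨i, -, rfl⟩ := mem_image.1 hy
      rw [Multiset.mem_toFinset, mem_aroots]
      exact ⟨hirr.ne_zero, hroot i⟩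
    · rw [card_image_of_injOn hinj, Multiset.toFinset_card_of_nodup hnodup, card_range, hm,
        aroots_def, ← (IsAlgClosed.splits _).natDegree_eq_card_roots, natDegree_map]
  have hsum : rootSum K f P = ∑ i ∈ range m, (aeval x f) ^ p ^ i := by
    simp_rw [← aeval_pow_prime_pow]
    rw [← Finset.sum_image (f := fun y => aeval y f) hinj, himg, rootSum, Finset.sum,
      Multiset.toFinset_val, hnodup.dedup]
  have hmn : m ∣ n := (hdvd n).2 ((mem_frobFixed hn).1 hx)
  refine ⟨hmn, ?_⟩
  obtain ⟨q, rfl⟩ := hmn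
  rw [Nat.mul_div_cancel_left _ hm0, hsum]
  clear hn hx
  induction q with
  | zero => simp
  | succ q ih =>
    rw [succ_nsmul, ih, mul_add, mul_one, sum_range_add]
    congr 1
    refine Finset.sum_congr rfl fun i _ => ?_
    rw [← aeval_pow_prime_pow, ← aeval_pow_prime_pow, pow_add, pow_mul,
      (hdvd _).1 (dvd_mul_right m q)]

end Frobenius

section MonicPolynomials

open Polynomial

variable {F : Type*} [Field F]

lemma finite_setOf_monic_natDegree [Finite F] (d : ℕ) :
    {g : F[X] | g.Monic ∧ g.natDegree = d}.Finite := by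
  refine Set.Finite.of_finite_image (f := fun g (i : Fin (d + 1)) => g.coeff i)
    (Set.toFinite _) ?_
  intro g hg h hh hgh
  rw [ext_iff_natDegree_le (n := d) hg.2.le hh.2.le]
  intro i hi
  exact congrFun hgh ⟨i, by omega⟩

/-- The monic polynomials of degree `d` over a finite field. -/
noncomputable def monicsOfDegree (F : Type*) [Field F] [Finite F] (d : ℕ) : Finset F[X] :=
  (finite_setOf_monic_natDegree d).toFinset

lemma mem_monicsOfDegree [Finite F] {d : ℕ} {g : F[X]} :
    g ∈ monicsOfDegree F d ↔ g.Monic ∧ g.natDegree = d := by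
  simp [monicsOfDegree]

lemma minpoly_pow_dvd_iff [PerfectField F] {K : Type*} [Field K] [Algebra F K] {x : K}
    (hx : IsIntegral F x) {j : ℕ} {g : F[X]} (hg : g ≠ 0) :
    minpoly F x ^ j ∣ g ↔ j ≤ (g.map (algebraMap F K)).rootMultiplicity x := by
  rw [le_rootMultiplicity_iff (map_ne_zero hg)]
  set P := minpoly F x with hP
  have hPx : (X - C x) ∣ P.map (algebraMap F K) := by
    rw [dvd_iff_isRoot, IsRoot, eval_map_algebraMap, hP, minpoly.aeval]
  obtain ⟨Q, hQ⟩ := hPx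
  have hsep : (P.map (algebraMap F K)).Separable :=
    (PerfectField.separable_of_irreducible (minpoly.irreducible hx)).map
  have hcop : IsCoprime (X - C x) Q := by
    rw [hQ] at hsep
    exact hsep.isCoprime
  constructor
  · rintro ⟨h, rfl⟩
    rw [Polynomial.map_mul, Polynomial.map_pow, hQ, mul_pow, mul_assoc]
    exact dvd_mul_right _ _
  · induction j generalizing g with
    | zero => simp
    | succ j ih =>
      intro hdvd
      have h1 : P ∣ g := by
        refine minpoly.dvd F x ?_
        rw [← eval_map_algebraMap, ← IsRoot, ← dvd_iff_isRoot]
        exact (dvd_pow_self _ j.succ_ne_zero).trans hdvd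
      obtain ⟨h, rfl⟩ := h1
      rw [pow_succ']
      refine mul_dvd_mul_left P (ih (right_ne_zero_of_mul hg) ?_)
      rw [Polynomial.map_mul, hQ, pow_succ', mul_assoc] at hdvd
      exact (hcop.pow_left).dvd_of_dvd_mul_left
        ((mul_dvd_mul_iff_left (X_sub_C_ne_zero x)).1 hdvd)

open scoped Classical in
lemma rootMultiplicity_eq_sum [PerfectField F] {K : Type*} [Field K] [Algebra F K] {x : K}
    (hx : IsIntegral F x) {n : ℕ} {g : F[X]} (hg : g ≠ 0) (hgn : g.natDegree ≤ n) :
    (g.map (algebraMap F K)).rootMultiplicity x =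
      ((Icc 1 n).filter fun j => minpoly F x ^ j ∣ g).card := by
  have : ((Icc 1 n).filter fun j => minpoly F x ^ j ∣ g) =
      Icc 1 ((g.map (algebraMap F K)).rootMultiplicity x) := by
    ext j
    have h := (Multiset.count_le_card x _).trans (card_roots' (g.map (algebraMap F K)))
    rw [natDegree_map, count_roots] at h
    simp only [mem_filter, mem_Icc, minpoly_pow_dvd_iff hx hg]
    omega
  rw [this, Nat.card_Icc, Nat.add_sub_cancel]

open scoped Classical in
/-- A completely multiplicative function summed over the multiples of `P`. -/
lemma sum_filter_dvd_monicsOfDegree [Finite F] {Φ : F[X] → ℂ}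
    (hmul : ∀ g h : F[X], g.Monic → h.Monic → Φ (g * h) = Φ g * Φ h) {P : F[X]} (hP : P.Monic)
    (n : ℕ) :
    ∑ g ∈ monicsOfDegree F n with P ∣ g, Φ g =
      if P.natDegree ≤ n then Φ P * ∑ g ∈ monicsOfDegree F (n - P.natDegree), Φ g else 0 := by
  split_ifs with h
  · rw [mul_sum]
    symm
    refine sum_bij (fun g _ => P * g) ?_ ?_ ?_ ?_
    · intro g hg
      rw [mem_monicsOfDegree] at hg
      rw [mem_filter, mem_monicsOfDegree]
      exact ⟨⟨hP.mul hg.1, by rw [hP.natDegree_mul hg.1, hg.2]; omega⟩, dvd_mul_right _ _⟩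
    · intro g _ h _ hgh
      exact mul_left_cancel₀ hP.ne_zero hgh
    · intro g hg
      rw [mem_filter, mem_monicsOfDegree] at hg
      obtain ⟨⟨hg1, hg2⟩, q, rfl⟩ := hg
      have hq := hP.of_mul_monic_left hg1
      refine ⟨q, mem_monicsOfDegree.2 ⟨hq, ?_⟩, rfl⟩
      rw [hP.natDegree_mul hq] at hg2
      omega
    · intro g hg
      rw [hmul _ _ hP (mem_monicsOfDegree.1 hg).1]
  · refine sum_eq_zero fun g hg => ?_
    rw [mem_filter, mem_monicsOfDegree] at hg
    exact absurd (natDegree_le_of_dvd hg.2 hg.1.1.ne_zero) (by omega)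

end MonicPolynomials

section Recursion

open Polynomial

variable {p : ℕ} [hp : Fact p.Prime] {K : Type} [Field K] [DecidableEq K] [Algebra (ZMod p) K]

open scoped Classical in
/-- The coefficient form of `t L'(t) = S(t) L(t)`. -/
lemma nat_mul_sum_monicsOfDegree [IsAlgClosed K] {Φ : (ZMod p)[X] → ℂ} (hone : Φ 1 = 1)
    (hmul : ∀ g h : (ZMod p)[X], g.Monic → h.Monic → Φ (g * h) = Φ g * Φ h) (n : ℕ) :
    n * ∑ g ∈ monicsOfDegree (ZMod p) n, Φ g =
      ∑ k ∈ Icc 1 n, (∑ x ∈ frobFixed p K k,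
        Φ (minpoly (ZMod p) x) ^ (k / (minpoly (ZMod p) x).natDegree)) *
          ∑ g ∈ monicsOfDegree (ZMod p) (n - k), Φ g := by
  set A : ℕ → ℂ := fun d => ∑ g ∈ monicsOfDegree (ZMod p) d, Φ g with hA
  set U : Finset K := (Icc 1 n).biUnion fun k => frobFixed p K k with hU
  have hUint : ∀ x ∈ U, IsIntegral (ZMod p) x := by
    intro x hx
    obtain ⟨k, hk, hxk⟩ := mem_biUnion.1 hx
    exact isIntegral_of_mem_frobFixed (by have := mem_Icc.1 hk; omega) hxk
  have hpow : ∀ P : (ZMod p)[X], P.Monic → ∀ j, Φ (P ^ j) = Φ P ^ j := by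
    intro P hP j
    induction j with
    | zero => simpa using hone
    | succ j ih => rw [pow_succ, hmul _ _ (hP.pow j) hP, ih, pow_succ]
  have hcount : ∀ g ∈ monicsOfDegree (ZMod p) n,
      n = ∑ x ∈ U, ((Icc 1 n).filter fun j => minpoly (ZMod p) x ^ j ∣ g).card := by
    intro g hg
    obtain ⟨hgm, hgn⟩ := mem_monicsOfDegree.1 hg
    have hmap : g.map (algebraMap (ZMod p) K) ≠ 0 := map_ne_zero hgm.ne_zero
    have h1 : n = ∑ x ∈ (g.aroots K).toFinset, (g.aroots K).count x := by
      rw [Multiset.toFinset_sum_count_eq, aroots_def,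
        ← (IsAlgClosed.splits _).natDegree_eq_card_roots, natDegree_map, hgn]
    refine h1.trans ?_
    rw [Finset.sum_congr rfl fun x hx =>
      (rootMultiplicity_eq_sum (hUint x hx) hgm.ne_zero hgn.le).symm]
    simp_rw [aroots_def, count_roots]
    refine sum_subset ?_ ?_
    · intro x hx
      rw [Multiset.mem_toFinset, ← aroots_def, mem_aroots] at hx
      have hxint : IsIntegral (ZMod p) x := ⟨g, hgm, by simpa [aeval_def] using hx.2⟩
      refine mem_biUnion.2 ⟨(minpoly (ZMod p) x).natDegree, mem_Icc.2 ⟨minpoly.natDegree_pos hxint,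
        hgn ▸ natDegree_le_of_dvd (minpoly.dvd _ _ hx.2) hgm.ne_zero⟩, ?_⟩
      rw [mem_frobFixed (minpoly.natDegree_pos hxint).ne', ← natDegree_minpoly_dvd_iff hxint]
    · intro x _ hx
      rw [Multiset.mem_toFinset, mem_roots hmap] at hx
      exact rootMultiplicity_eq_zero hx
  have hL : n * A n = ∑ x ∈ U, ∑ j ∈ Icc 1 n, if j * (minpoly (ZMod p) x).natDegree ≤ n then
      Φ (minpoly (ZMod p) x) ^ j * A (n - j * (minpoly (ZMod p) x).natDegree) else 0 := by
    have h1 : n * A n = ∑ g ∈ monicsOfDegree (ZMod p) n, ∑ x ∈ U, ∑ j ∈ Icc 1 n,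
        if minpoly (ZMod p) x ^ j ∣ g then Φ g else 0 := by
      rw [hA, mul_sum]
      refine Finset.sum_congr rfl fun g hg => ?_
      conv_lhs => rw [hcount g hg]
      push_cast
      rw [sum_mul]
      refine Finset.sum_congr rfl fun x hx => ?_
      rw [← sum_filter, sum_const, nsmul_eq_mul]
    rw [h1, sum_comm]
    refine Finset.sum_congr rfl fun x hx => ?_
    rw [sum_comm]
    refine Finset.sum_congr rfl fun j hj => ?_
    have hm := minpoly.monic (hUint x hx)
    rw [← sum_filter, sum_filter_dvd_monicsOfDegree hmul (hm.pow j), hpow _ hm,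
      hm.natDegree_pow]
  have hR : ∀ k ∈ Icc 1 n, (∑ x ∈ frobFixed p K k,
        Φ (minpoly (ZMod p) x) ^ (k / (minpoly (ZMod p) x).natDegree)) * A (n - k) =
      ∑ x ∈ U, if (minpoly (ZMod p) x).natDegree ∣ k then
        Φ (minpoly (ZMod p) x) ^ (k / (minpoly (ZMod p) x).natDegree) * A (n - k) else 0 := by
    intro k hk
    have hk0 : k ≠ 0 := by have := mem_Icc.1 hk; omega
    rw [sum_mul, ← sum_filter]
    refine Finset.sum_congr ?_ fun _ _ => rfl
    ext x
    rw [mem_filter]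
    constructor
    · intro hx
      exact ⟨mem_biUnion.2 ⟨k, hk, hx⟩, (natDegree_minpoly_dvd_iff
        (isIntegral_of_mem_frobFixed hk0 hx)).2 ((mem_frobFixed hk0).1 hx)⟩
    · rintro ⟨hx, hdvd⟩
      exact (mem_frobFixed hk0).2 ((natDegree_minpoly_dvd_iff (hUint x hx)).1 hdvd)
  change n * A n = ∑ k ∈ Icc 1 n, _ * A (n - k)
  rw [hL, Finset.sum_congr rfl hR, sum_comm (s := Icc 1 n)]
  refine Finset.sum_congr rfl fun x hx => ?_
  have hm0 := minpoly.natDegree_pos (hUint x hx)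
  set m := (minpoly (ZMod p) x).natDegree
  rw [← sum_filter, ← sum_filter]
  refine sum_bij (fun j _ => j * m) ?_ ?_ ?_ ?_
  · intro j hj
    rw [mem_filter, mem_Icc] at hj ⊢
    exact ⟨⟨Nat.mul_pos hj.1.1 hm0, hj.2⟩, dvd_mul_left _ _⟩
  · intro i _ j _ hij
    exact Nat.eq_of_mul_eq_mul_right hm0 hij
  · intro k hk
    rw [mem_filter, mem_Icc] at hk
    obtain ⟨⟨h1, h2⟩, j, rfl⟩ := hk
    refine ⟨j, ?_, mul_comm _ _⟩
    have hj : 0 < j := Nat.pos_of_mul_pos_left h1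
    rw [mem_filter, mem_Icc]
    exact ⟨⟨hj, (Nat.le_mul_of_pos_left j hm0).trans h2⟩, by rwa [mul_comm]⟩
  · intro j _
    rw [Nat.mul_div_cancel _ hm0]

end Recursion

section LFunction

open Polynomial

variable {p : ℕ} [hp : Fact p.Prime]

lemma mem_range_algebraMap_of_pow_eq {K : Type} [Field K] [Algebra (ZMod p) K] {y : K}
    (hy : y ^ p = y) : ∃ a, algebraMap (ZMod p) K a = y := by
  classical
  have hne := FiniteField.X_pow_card_sub_X_ne_zero K hp.out.one_lt
  have hsub : (univ : Finset (ZMod p)).image (algebraMap (ZMod p) K) ⊆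
      (X ^ p - X : K[X]).roots.toFinset := by
    intro z hz
    obtain ⟨a, -, rfl⟩ := mem_image.1 hz
    simp [mem_roots hne, ← map_pow]
  have heq := eq_of_subset_of_card_le hsub (by
    rw [card_image_of_injective _ (algebraMap (ZMod p) K).injective, card_univ, ZMod.card]
    refine (Multiset.toFinset_card_le _).trans ((card_roots' _).trans ?_)
    rw [FiniteField.X_pow_card_sub_X_natDegree_eq K hp.out.one_lt])
  have : y ∈ (X ^ p - X : K[X]).roots.toFinset := by simp [mem_roots hne, hy]
  rw [← heq] at this
  obtain ⟨a, -, ha⟩ := mem_image.1 this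
  exact ⟨a, ha⟩

/-- The coefficients of the `L`-function of the character sum `∑ ψ (f x)`, together with those of
its logarithmic derivative. -/
lemma exists_lFunction_coeff (f : (ZMod p)[X]) (hD : 0 < f.natDegree)
    (hcop : p.Coprime f.natDegree) {ψ : AddChar (ZMod p) ℂ} (hψ : ψ ≠ 1) :
    ∃ A S : ℕ → ℂ, A 0 = 1 ∧ A 1 = ∑ x, ψ (f.eval x) ∧ (∀ d, f.natDegree ≤ d → A d = 0) ∧
      (∀ n : ℕ, n * A n = ∑ k ∈ Icc 1 n, S k * A (n - k)) ∧
      ∃ C : ℝ, ∀ n : ℕ, n ≠ 0 → ‖S n‖ ≤ C * √p ^ n := by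
  classical
  let K := AlgebraicClosure (ZMod p)
  have _ : CharP K p := charP_of_injective_algebraMap (algebraMap (ZMod p) K).injective p
  obtain ⟨π, hπ⟩ := (Algebra.linearMap (ZMod p) K).exists_leftInverse_of_injective
    (LinearMap.ker_eq_bot.2 (algebraMap (ZMod p) K).injective)
  replace hπ : ∀ a, π (algebraMap (ZMod p) K a) = a := fun a => LinearMap.congr_fun hπ a
  set Φ : (ZMod p)[X] → ℂ := fun g => ψ (π (rootSum K f g)) with hΦ
  have hone : Φ 1 = 1 := by simp [hΦ, rootSum_one]
  have hmul : ∀ g h : (ZMod p)[X], g.Monic → h.Monic → Φ (g * h) = Φ g * Φ h := by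
    intro g h hg hh
    simp only [hΦ]
    rw [rootSum_mul f hg.ne_zero hh.ne_zero, map_add, AddChar.map_add_eq_mul]
  refine ⟨fun d => ∑ g ∈ monicsOfDegree (ZMod p) d, Φ g, fun k => ∑ x ∈ frobFixed p K k,
        Φ (minpoly (ZMod p) x) ^ (k / (minpoly (ZMod p) x).natDegree), ?_, ?_, ?_,
        nat_mul_sum_monicsOfDegree hone hmul, ?_⟩
  · have : monicsOfDegree (ZMod p) 0 = {1} := by
      ext g
      rw [mem_monicsOfDegree, mem_singleton]
      exact ⟨fun h => h.1.natDegree_eq_zero.1 h.2, by rintro rfl; simp⟩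
    simp only [this, sum_singleton, hone]
  · symm
    refine sum_bij (fun a _ => X + C (-a)) ?_ ?_ ?_ ?_
    · intro a _
      exact mem_monicsOfDegree.2 ⟨monic_X_add_C _, natDegree_X_add_C _⟩
    · intro a _ b _ hab
      simpa using hab
    · intro g hg
      rw [mem_monicsOfDegree] at hg
      refine ⟨-g.coeff 0, mem_univ _, ?_⟩
      rw [neg_neg, ← hg.1.eq_X_add_C hg.2]
    · intro a _
      simp only [hΦ]
      rw [rootSum_X_add_C, neg_neg, hπ]
  · intro d hd
    obtain ⟨c, hc⟩ : ∃ c, ψ c ≠ 1 := by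
      by_contra! h
      exact hψ (by ext a; simp [h])
    have hD0 : (f.natDegree : ZMod p) ≠ 0 := by
      rw [Ne, ZMod.natCast_eq_zero_iff]
      exact fun h => hp.out.one_lt.ne' (Nat.dvd_one.1 (hcop ▸ Nat.dvd_gcd dvd_rfl h))
    have hl0 : f.leadingCoeff ≠ 0 := leadingCoeff_ne_zero.2 (by rintro rfl; simp at hD)
    set b := -c / (f.natDegree * f.leadingCoeff) with hb
    have hb' : f.natDegree * b * f.leadingCoeff = -c := by rw [hb]; field_simp
    have hshift : ∀ g ∈ monicsOfDegree (ZMod p) d, ∀ b : ZMod p,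
        g + C b * X ^ (d - f.natDegree) ∈ monicsOfDegree (ZMod p) d := by
      intro g hg b
      obtain ⟨hg1, hg2⟩ := mem_monicsOfDegree.1 hg
      have hlt : (C b * X ^ (d - f.natDegree)).degree < g.degree := by
        rw [degree_eq_natDegree hg1.ne_zero, hg2]
        refine (degree_C_mul_X_pow_le _ _).trans_lt ?_
        exact_mod_cast (by omega : d - f.natDegree < d)
      exact mem_monicsOfDegree.2 ⟨hg1.add_of_left hlt,
        (natDegree_add_eq_left_of_degree_lt hlt).trans hg2⟩
    have heq : ∑ g ∈ monicsOfDegree (ZMod p) d, Φ g =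
        ψ c * ∑ g ∈ monicsOfDegree (ZMod p) d, Φ g := by
      rw [mul_sum]
      symm
      refine sum_bij (fun g _ => g + C b * X ^ (d - f.natDegree))
        (fun g hg => hshift g hg b) ?_ ?_ ?_
      · intro g _ h _ hgh
        exact add_right_cancel hgh
      · intro g hg
        refine ⟨g + C (-b) * X ^ (d - f.natDegree), hshift g hg (-b), ?_⟩
        simp
      · intro g hg
        obtain ⟨hg1, hg2⟩ := mem_monicsOfDegree.1 hg
        simp only [hΦ]
        rw [← hg2, rootSum_add_C_mul_X_pow f hD hg1 (by omega), map_sub, hπ, hb', sub_neg_eq_add,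
          AddChar.map_add_eq_mul, mul_comm]
    have : (1 - ψ c) * ∑ g ∈ monicsOfDegree (ZMod p) d, Φ g = 0 := by linear_combination heq
    exact (mul_eq_zero.1 this).resolve_left (sub_ne_zero.2 hc.symm)
  · obtain ⟨B, hB⟩ := norm_sum_trace_le (K := K) f hD hcop hψ
    refine ⟨B, fun n hn => ?_⟩
    have hfrob : ∀ x ∈ frobFixed p K n, (∑ i ∈ range n, (aeval x f) ^ p ^ i) ^ p =
        ∑ i ∈ range n, (aeval x f) ^ p ^ i := by
      intro x hx
      have hy : aeval x f ^ p ^ n = aeval x f := by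
        rw [← aeval_pow_prime_pow, (mem_frobFixed hn).1 hx]
      have h1 := sum_range_succ (fun i => aeval x f ^ p ^ i) n
      rw [sum_range_succ', hy, pow_zero, pow_one, add_left_inj] at h1
      rw [sum_pow_char, ← h1]
      simp_rw [← pow_mul, ← pow_succ]
    convert hB n hn (fun x => π (∑ i ∈ range n, (aeval x f) ^ p ^ i)) ?_ using 2
    · refine Finset.sum_congr rfl fun x hx => ?_
      rw [← (nsmul_rootSum_minpoly f hn hx).2, map_nsmul, AddChar.map_nsmul_eq_pow]
    · intro x hx
      obtain ⟨a, ha⟩ := mem_range_algebraMap_of_pow_eq (hfrob x hx)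
      rw [← ha, hπ]

end LFunction

section LogDerivative

open Polynomial Topology

/-- A polynomial whose logarithmic derivative is bounded near a point does not vanish there. -/
lemma eval_ne_zero_of_norm_mul_derivative_le {L : ℂ[X]} (hL : L ≠ 0) {t₀ : ℂ} (ht₀ : t₀ ≠ 0) {B : ℝ}
    (h : ∀ᶠ t in 𝓝 t₀, ‖t * L.derivative.eval t‖ ≤ B * ‖L.eval t‖) : L.eval t₀ ≠ 0 := by
  intro hroot
  obtain ⟨M, hLM, hM⟩ := L.exists_eq_pow_rootMultiplicity_mul_and_not_dvd hL t₀
  have hk : 0 < L.rootMultiplicity t₀ := (rootMultiplicity_pos hL).2 hroot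
  obtain ⟨k, hk⟩ : ∃ k, L.rootMultiplicity t₀ = k + 1 := ⟨_, (Nat.sub_add_cancel hk).symm⟩
  rw [hk] at hLM
  rw [dvd_iff_isRoot, IsRoot] at hM
  have hev : ∀ᶠ t in 𝓝[≠] t₀, ‖t * ((k + 1) * M.eval t + (t - t₀) * M.derivative.eval t)‖ ≤
      B * ‖(t - t₀) * M.eval t‖ := by
    filter_upwards [h.filter_mono nhdsWithin_le_nhds, self_mem_nhdsWithin] with t ht hne
    have hne' : t - t₀ ≠ 0 := sub_ne_zero.2 hne
    have hpos : 0 < ‖(t - t₀) ^ k‖ := norm_pos_iff.2 (pow_ne_zero _ hne')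
    have e1 : L.derivative.eval t =
        (t - t₀) ^ k * ((k + 1) * M.eval t + (t - t₀) * M.derivative.eval t) := by
      rw [hLM]
      simp only [derivative_mul, derivative_X_sub_C_pow, eval_add, eval_mul, eval_pow, eval_sub,
        eval_X, eval_C, Nat.add_sub_cancel]
      push_cast
      ring
    have e2 : L.eval t = (t - t₀) ^ k * ((t - t₀) * M.eval t) := by
      rw [hLM]
      simp only [eval_mul, eval_pow, eval_sub, eval_X, eval_C]
      ring
    rw [e1, e2, mul_left_comm, norm_mul, norm_mul ((t - t₀) ^ k), mul_left_comm] at ht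
    exact le_of_mul_le_mul_left ht hpos
  have hlim := le_of_tendsto_of_tendsto (b := 𝓝[≠] t₀)
    (((continuous_id.mul ((continuous_const.mul M.continuous).add
      ((continuous_id.sub continuous_const).mul M.derivative.continuous))).norm.tendsto
        t₀).mono_left nhdsWithin_le_nhds)
    ((continuous_const.mul ((continuous_id.sub continuous_const).mul M.continuous).norm).tendsto
      t₀ |>.mono_left nhdsWithin_le_nhds) hev
  simp only [id_eq, Pi.mul_apply, Pi.add_apply, Pi.sub_apply, sub_self, zero_mul, add_zero,
    norm_zero, mul_zero, norm_le_zero_iff, mul_eq_zero, ht₀, hM, or_false, false_or] at hlim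
  exact absurd hlim (by exact_mod_cast k.succ_ne_zero)

lemma hasSum_coeff_mul_pow (Q : ℂ[X]) (t : ℂ) : HasSum (fun n => Q.coeff n * t ^ n) (Q.eval t) := by
  rw [eval_eq_sum_range]
  refine hasSum_sum_of_ne_finset_zero fun n hn => ?_
  rw [coeff_eq_zero_of_natDegree_lt (by simpa [Nat.lt_succ_iff] using hn), zero_mul]

lemma summable_norm_coeff_mul_pow (Q : ℂ[X]) (t : ℂ) : Summable fun n => ‖Q.coeff n * t ^ n‖ := by
  refine summable_of_ne_finset_zero (s := range (Q.natDegree + 1)) fun n hn => ?_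
  rw [coeff_eq_zero_of_natDegree_lt (by simpa [Nat.lt_succ_iff] using hn), zero_mul, norm_zero]

lemma norm_mul_derivative_le {L : ℂ[X]} {S : ℕ → ℂ} {B q ρ : ℝ}
    (hrec : ∀ n : ℕ, n * L.coeff n = ∑ k ∈ Icc 1 n, S k * L.coeff (n - k))
    (hS : ∀ n : ℕ, n ≠ 0 → ‖S n‖ ≤ B * q ^ n) (hB : 0 ≤ B) (hq : 0 < q) (hρ : ρ < 1) {t : ℂ}
    (ht : q * ‖t‖ ≤ ρ) : ‖t * L.derivative.eval t‖ ≤ B * (1 - ρ)⁻¹ * ‖L.eval t‖ := by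
  set s : ℕ → ℂ := fun n => if n = 0 then 0 else S n * t ^ n with hs
  have hsn : ∀ n, ‖s n‖ ≤ B * ρ ^ n := by
    intro n
    have hρ0 : 0 ≤ ρ := le_trans (by positivity) ht
    by_cases hn : n = 0
    · simp only [hs, hn, if_true, norm_zero]
      positivity
    · simp only [hs, hn, if_false, norm_mul, norm_pow]
      calc ‖S n‖ * ‖t‖ ^ n ≤ B * q ^ n * ‖t‖ ^ n := by gcongr; exact hS n hn
        _ = B * (q * ‖t‖) ^ n := by rw [mul_pow, mul_assoc]
        _ ≤ B * ρ ^ n := by gcongr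
  have hgeo : HasSum (fun n => B * ρ ^ n) (B * (1 - ρ)⁻¹) :=
    (hasSum_geometric_of_lt_one (le_trans (by positivity) ht) hρ).mul_left B
  have hsum : Summable fun n => ‖s n‖ :=
    Summable.of_nonneg_of_le (fun _ => norm_nonneg _) hsn hgeo.summable
  have hprod := tsum_mul_tsum_eq_tsum_sum_antidiagonal_of_summable_norm hsum
    (summable_norm_coeff_mul_pow L t)
  rw [(hasSum_coeff_mul_pow L t).tsum_eq] at hprod
  have hX := (hasSum_coeff_mul_pow (X * L.derivative) t).tsum_eq
  have heq : t * L.derivative.eval t = (∑' n, s n) * L.eval t := by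
    rw [hprod, show t * L.derivative.eval t = (X * L.derivative).eval t by simp, ← hX]
    refine tsum_congr fun n => ?_
    have hn : (X * L.derivative).coeff n = n * L.coeff n := by
      cases n with
      | zero => simp
      | succ n => rw [coeff_X_mul, coeff_derivative]; push_cast; ring
    rw [hn, hrec, sum_mul, Nat.sum_antidiagonal_eq_sum_range_succ_mk, range_eq_Ico,
      sum_eq_sum_Ico_succ_bot n.succ_pos]
    simp only [hs, if_true, zero_mul, zero_add]
    refine Finset.sum_congr (by ext; simp) fun k hk => ?_
    have hk' := mem_Icc.1 hk
    rw [if_neg (by omega), mul_mul_mul_comm, ← pow_add, Nat.add_sub_cancel' (by omega)]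
  rw [heq, norm_mul]
  gcongr
  exact (norm_tsum_le_tsum_norm hsum).trans ((hsum.tsum_le_tsum hsn hgeo.summable).trans_eq
    hgeo.tsum_eq)

lemma norm_coeff_one_le_of_recursion {A S : ℕ → ℂ} {D : ℕ} {B q : ℝ} (hq : 0 < q)
    (hA0 : A 0 = 1) (hAD : ∀ d, D ≤ d → A d = 0)
    (hrec : ∀ n : ℕ, n * A n = ∑ k ∈ Icc 1 n, S k * A (n - k))
    (hS : ∀ n : ℕ, n ≠ 0 → ‖S n‖ ≤ B * q ^ n) : ‖A 1‖ ≤ (D - 1 : ℕ) * q := by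
  set L : ℂ[X] := ∑ d ∈ range D, C (A d) * X ^ d with hLdef
  have hcoeff : ∀ d, L.coeff d = A d := by
    intro d
    simp only [hLdef, finsetSum_coeff, coeff_C_mul_X_pow]
    by_cases hd : d < D
    · simp [hd]
    · simp [hd, hAD d (not_lt.1 hd)]
  have hL : L ≠ 0 := fun h => by simpa [h, hA0] using hcoeff 0
  have hdeg : L.natDegree ≤ D - 1 := by
    refine natDegree_le_iff_coeff_eq_zero.2 fun N hN => ?_
    rw [hcoeff, hAD _ (by omega)]
  have hB : 0 ≤ B := nonneg_of_mul_nonneg_left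
    ((norm_nonneg _).trans (hS 1 one_ne_zero)) (by positivity)
  have hroots : ∀ t : ℂ, L.eval t = 0 → 1 ≤ q * ‖t‖ := by
    intro t₀ ht₀
    by_contra! hlt
    refine eval_ne_zero_of_norm_mul_derivative_le (t₀ := t₀)
      (B := B * (1 - (1 + q * ‖t₀‖) / 2)⁻¹) hL ?_ ?_ ht₀
    · rintro rfl
      rw [← coeff_zero_eq_eval_zero, hcoeff, hA0] at ht₀
      exact one_ne_zero ht₀
    · have hev : ∀ᶠ t in 𝓝 t₀, q * ‖t‖ < (1 + q * ‖t₀‖) / 2 :=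
        (by fun_prop : Continuous fun t : ℂ => q * ‖t‖).continuousAt.eventually_lt_const
          (by linarith)
      filter_upwards [hev] with t ht
      exact norm_mul_derivative_le (ρ := (1 + q * ‖t₀‖) / 2) (by simpa only [hcoeff] using hrec)
        hS hB hq (by linarith) ht.le
  set R := L.reverse with hR
  have htail : L.natTrailingDegree = 0 :=
    natTrailingDegree_eq_zero.2 (Or.inr (by rw [hcoeff, hA0]; exact one_ne_zero))
  have hRmonic : R.Monic := by
    rw [Monic, hR, reverse_leadingCoeff, trailingCoeff, htail, hcoeff, hA0]
  have hRdeg : R.natDegree = L.natDegree := by rw [hR, reverse_natDegree, htail, Nat.sub_zero]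
  have hA1 : A 1 = R.nextCoeff := by
    rw [← hcoeff, nextCoeff, hRdeg]
    split_ifs with h0
    · exact coeff_eq_zero_of_natDegree_lt (by omega)
    · rw [hR, coeff_reverse, revAt_le (by omega), Nat.sub_sub_self (by omega)]
  rw [hA1, (IsAlgClosed.splits R).nextCoeff_eq_neg_sum_roots_of_monic hRmonic, norm_neg]
  have hz : ∀ z ∈ R.roots, ‖z‖ ≤ q := by
    intro z hz
    by_cases hz0 : z = 0
    · simp [hz0, hq.le]
    have hzi : L.eval z⁻¹ = 0 := by
      have hinv := invertibleOfNonzero (inv_ne_zero hz0)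
      have := (eval₂_reverse_eq_zero_iff (RingHom.id ℂ) z⁻¹ L).1
      rw [invOf_eq_inv, inv_inv] at this
      exact this (mem_roots hRmonic.ne_zero |>.1 hz)
    have h1 := hroots _ hzi
    rw [norm_inv, ← div_eq_mul_inv, one_le_div (norm_pos_iff.2 hz0)] at h1
    exact h1
  calc ‖R.roots.sum‖ ≤ (R.roots.map fun z => ‖z‖).sum := norm_multiset_sum_le _
    _ ≤ R.roots.card • q := by
      have := Multiset.sum_le_card_nsmul (R.roots.map fun z => ‖z‖) q fun x hx => by
        obtain ⟨z, hz', rfl⟩ := Multiset.mem_map.1 hx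
        exact hz z hz'
      rwa [Multiset.card_map] at this
    _ ≤ (D - 1 : ℕ) * q := by
      rw [nsmul_eq_mul]
      gcongr
      exact (card_roots' R).trans (hRdeg.trans_le hdeg)

end LogDerivative

open Polynomial in
/-- Weil's bound for additive character sums over a prime field. -/
theorem norm_sum_addChar_eval_le {p : ℕ} [Fact p.Prime] (f : (ZMod p)[X]) (hD : 0 < f.natDegree)
    (hcop : p.Coprime f.natDegree) {ψ : AddChar (ZMod p) ℂ} (hψ : ψ ≠ 1) :
    ‖∑ x, ψ (f.eval x)‖ ≤ (f.natDegree - 1 : ℕ) * √p := by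
  obtain ⟨A, S, hA0, hA1, hAD, hrec, B, hB⟩ := exists_lFunction_coeff f hD hcop hψ
  rw [← hA1]
  exact norm_coeff_one_le_of_recursion
    (Real.sqrt_pos.2 (by exact_mod_cast (Fact.out : p.Prime).pos)) hA0 hAD hrec hB

section Interval

open Real

lemma one_div_sin_le {x : ℝ} (hx : 0 < x) (hx' : x < π) :
    1 / sin x ≤ 4 / 3 / x + 4 / 3 / (π - x) + 2 := by
  have key : ∀ y : ℝ, 0 < y → y ≤ π / 2 → 1 / sin y ≤ 4 / 3 / y + 2 := by
    intro y hy hy'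
    rcases le_total y 1 with h1 | h1
    · have h2 : 3 / 4 * y ≤ sin y := by
        nlinarith [sin_gt_sub_cube hy, mul_pos hy hy, mul_nonneg hy.le (sub_nonneg.2 h1),
          mul_nonneg (mul_pos hy hy).le (sub_nonneg.2 h1)]
      calc 1 / sin y ≤ 1 / (3 / 4 * y) := by gcongr
        _ = 4 / 3 / y := by field_simp
        _ ≤ _ := by linarith
    · have h2 : 1 / 2 ≤ sin y := by
        refine le_trans ?_ (mul_le_sin hy.le hy')
        rw [div_mul_eq_mul_div, div_le_div_iff₀ (by norm_num) pi_pos]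
        linarith [pi_le_four]
      calc 1 / sin y ≤ 1 / (1 / 2) := by gcongr
        _ ≤ _ := by norm_num; positivity
  rcases le_total x (π / 2) with h | h
  · have : 0 ≤ 4 / 3 / (π - x) := div_nonneg (by norm_num) (by linarith)
    linarith [key x hx h]
  · have : 0 ≤ 4 / 3 / x := by positivity
    have h2 := key (π - x) (by linarith) (by linarith)
    rw [sin_pi_sub] at h2
    linarith

lemma sum_one_div_sin_le {p : ℕ} (hp : 0 < p) :
    ∑ v ∈ Ico 1 p, 1 / sin (π * v / p) ≤ p * (0.85 * log p + 2.85) := by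
  have hp0 : (0 : ℝ) < p := by exact_mod_cast hp
  have hH : ∑ v ∈ Ico 1 p, (1 : ℝ) / v ≤ 1 + log p := by
    have h1 := harmonic_le_one_add_log (p - 1)
    have h2 : ((harmonic (p - 1) : ℚ) : ℝ) = ∑ v ∈ Ico 1 p, (1 : ℝ) / v := by
      rw [harmonic_eq_sum_Icc]
      push_cast
      refine Finset.sum_congr (by ext; simp; omega) fun v _ => by rw [one_div]
    rw [← h2]
    refine h1.trans ?_
    rcases Nat.eq_zero_or_pos (p - 1) with h | h
    · rw [h]; simpa using log_natCast_nonneg p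
    · gcongr
      omega
  have hH' : ∑ v ∈ Ico 1 p, (1 : ℝ) / (p - v : ℕ) = ∑ v ∈ Ico 1 p, (1 : ℝ) / v := by
    have := sum_Ico_reflect (fun v : ℕ => (1 : ℝ) / v) 1 (m := p) (n := p) (by omega)
    rw [this]
    simp
  have hterm : ∀ v ∈ Ico 1 p, 1 / sin (π * v / p) ≤
      4 * p / (3 * π) * (1 / v) + 4 * p / (3 * π) * (1 / (p - v : ℕ)) + 2 := by
    intro v hv
    obtain ⟨h1, h2⟩ := mem_Ico.1 hv
    have hv0 : (0 : ℝ) < v := by exact_mod_cast h1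
    have hvp : (v : ℝ) < p := by exact_mod_cast h2
    have hpv : (0 : ℝ) < p - v := by linarith
    refine (one_div_sin_le (x := π * v / p) (by positivity) ?_).trans_eq ?_
    · rw [div_lt_iff₀ hp0]
      exact mul_lt_mul_of_pos_left hvp pi_pos
    · have : π - π * v / p = π * (p - v) / p := by field_simp
      rw [this, Nat.cast_sub h2.le]
      field_simp
  refine (sum_le_sum hterm).trans ?_
  rw [sum_add_distrib, sum_add_distrib, ← mul_sum, ← mul_sum, hH', sum_const, Nat.card_Ico,
    nsmul_eq_mul, Nat.cast_sub hp]
  have hc : 4 * p / (3 * π) ≤ 0.425 * p := by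
    rw [div_le_iff₀ (by positivity)]
    nlinarith [pi_gt_d2]
  have h0 : 0 ≤ ∑ v ∈ Ico 1 p, (1 : ℝ) / v := sum_nonneg fun _ _ => by positivity
  calc _ ≤ 0.425 * p * (∑ v ∈ Ico 1 p, (1 : ℝ) / v) + 0.425 * p * (∑ v ∈ Ico 1 p, (1 : ℝ) / v) +
      p * 2 := by gcongr; simp
    _ = p * (0.85 * (∑ v ∈ Ico 1 p, (1 : ℝ) / v) + 2) := by ring
    _ ≤ p * (0.85 * (1 + log p) + 2) := by gcongr
    _ = _ := by ring

lemma norm_one_sub_stdAddChar {p : ℕ} [NeZero p] (a : ZMod p) :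
    ‖1 - ZMod.stdAddChar a‖ = 2 * sin (π * a.val / p) := by
  have h1 := ZMod.stdAddChar_coe (N := p) (a.val : ℤ)
  rw [Int.cast_natCast, ZMod.natCast_val, ZMod.cast_id] at h1
  have hp : (0 : ℝ) < p := by exact_mod_cast NeZero.pos p
  have h2 := Complex.norm_exp_I_mul_ofReal_sub_one (2 * π * a.val / p)
  rw [h1, norm_sub_rev]
  have harg : 2 * π * (a.val : ℝ) / p / 2 = π * a.val / p := by ring
  rw [harg, Real.norm_of_nonneg] at h2
  · rw [← h2]
    push_cast
    ring_nf
  · refine mul_nonneg zero_le_two (sin_nonneg_of_nonneg_of_le_pi (by positivity) ?_)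
    rw [div_le_iff₀ hp]
    have : (a.val : ℝ) ≤ p := by exact_mod_cast (ZMod.val_lt a).le
    gcongr

/-- The Fourier expansion of the indicator function of an interval, with an `ℓ¹` bound. -/
lemma exists_fourier_interval {p : ℕ} [Fact p.Prime] (r : ℤ) {s : ℕ} (hs : s ≤ p) :
    ∃ c : ZMod p → ℂ, c 0 = s / p ∧ ∑ a ∈ univ.erase 0, ‖c a‖ ≤ 0.85 * log p + 2.85 ∧
      ∀ y : ZMod p, ∑ a, c a * ZMod.stdAddChar (a * y) =
        if ∃ j < s, y = ((r + j : ℤ) : ZMod p) then 1 else 0 := by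
  have hp : (0 : ℝ) < p := by exact_mod_cast (Fact.out : p.Prime).pos
  have hpC : (p : ℂ) ≠ 0 := by exact_mod_cast hp.ne'
  set ψ : AddChar (ZMod p) ℂ := ZMod.stdAddChar with hψ
  refine ⟨fun a => (p : ℂ)⁻¹ * ∑ j ∈ range s, ψ (-(a * ((r + j : ℤ) : ZMod p))), ?_, ?_, ?_⟩
  · simp [div_eq_inv_mul]
  · have hbound : ∀ a ∈ (univ : Finset (ZMod p)).erase 0,
        ‖(p : ℂ)⁻¹ * ∑ j ∈ range s, ψ (-(a * ((r + j : ℤ) : ZMod p)))‖ ≤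
          (p : ℝ)⁻¹ * (1 / sin (π * (-a).val / p)) := by
      intro a ha
      have ha0 : a ≠ 0 := (mem_erase.1 ha).1
      have hz : ψ (-a) ≠ 1 := by
        rw [← AddChar.map_zero_eq_one ψ]
        exact fun h => ha0 (neg_eq_zero.1 (ZMod.injective_stdAddChar h))
      have hgeom : ∑ j ∈ range s, ψ (-(a * ((r + j : ℤ) : ZMod p))) =
          ψ (-(a * r)) * ((ψ (-a) ^ s - 1) / (ψ (-a) - 1)) := by
        rw [← geom_sum_eq hz, mul_sum]
        refine Finset.sum_congr rfl fun j _ => ?_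
        rw [← AddChar.map_nsmul_eq_pow, ← AddChar.map_add_eq_mul]
        congr 1
        push_cast
        rw [nsmul_eq_mul]
        ring
      have hpos : 0 < ‖1 - ψ (-a)‖ := norm_pos_iff.2 (sub_ne_zero.2 hz.symm)
      rw [hgeom, norm_mul, norm_inv, Complex.norm_natCast, norm_mul, AddChar.norm_apply, one_mul,
        norm_div, norm_sub_rev (ψ (-a)) 1]
      have h2 : ‖ψ (-a) ^ s - 1‖ ≤ 2 := by
        refine (norm_sub_le _ _).trans ?_
        rw [norm_pow, AddChar.norm_apply, one_pow, norm_one]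
        norm_num
      rw [hψ, norm_one_sub_stdAddChar] at hpos ⊢
      refine mul_le_mul_of_nonneg_left ?_ (by positivity)
      rw [div_le_div_iff₀ hpos (by linarith)]
      nlinarith
    refine (sum_le_sum hbound).trans ?_
    rw [← mul_sum, inv_mul_le_iff₀ hp]
    refine le_trans (le_of_eq ?_) (sum_one_div_sin_le (Fact.out : p.Prime).pos)
    refine sum_bij (fun a _ => (-a).val) ?_ ?_ ?_ ?_
    · intro a ha
      have ha0 : -a ≠ 0 := neg_ne_zero.2 (mem_erase.1 ha).1
      exact mem_Ico.2 ⟨Nat.pos_of_ne_zero (by rwa [Ne, ZMod.val_eq_zero]), ZMod.val_lt _⟩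
    · intro a _ b _ hab
      exact neg_injective (ZMod.val_injective p hab)
    · intro v hv
      obtain ⟨h1, h2⟩ := mem_Ico.1 hv
      refine ⟨-(v : ZMod p), mem_erase.2 ⟨?_, mem_univ _⟩, by rw [neg_neg, ZMod.val_cast_of_lt h2]⟩
      rw [neg_ne_zero, Ne, ZMod.natCast_eq_zero_iff]
      exact Nat.not_dvd_of_pos_of_lt h1 h2
    · intro a _
      rfl
  · intro y
    have h1 : ∑ a, (p : ℂ)⁻¹ * (∑ j ∈ range s, ψ (-(a * ((r + j : ℤ) : ZMod p)))) * ψ (a * y) =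
        ∑ j ∈ range s, if y = ((r + j : ℤ) : ZMod p) then 1 else 0 := by
      simp_rw [mul_sum, sum_mul]
      rw [sum_comm]
      refine Finset.sum_congr rfl fun j _ => ?_
      simp_rw [mul_assoc, ← AddChar.map_add_eq_mul]
      rw [← mul_sum]
      have := AddChar.sum_mulShift (y - ((r + j : ℤ) : ZMod p)) (ZMod.isPrimitive_stdAddChar p)
      simp only [ZMod.card, sub_eq_zero] at this
      rw [Finset.sum_congr rfl fun a _ => by
        rw [show -(a * ((r + j : ℤ) : ZMod p)) + a * y = a * (y - ((r + j : ℤ) : ZMod p)) by ring],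
        hψ, this]
      split_ifs <;> simp [hpC]
    rw [h1]
    split_ifs with h
    · obtain ⟨j, hj, rfl⟩ := h
      rw [sum_eq_single_of_mem j (mem_range.2 hj), if_pos rfl]
      intro i hi hij
      rw [if_neg]
      intro heq
      push_cast at heq
      have h3 := (ZMod.natCast_eq_natCast_iff' j i p).1 (add_left_cancel heq)
      rw [Nat.mod_eq_of_lt (by omega), Nat.mod_eq_of_lt (by have := mem_range.1 hi; omega)] at h3
      exact hij h3.symm
    · refine sum_eq_zero fun j hj => if_neg fun heq => h ⟨j, mem_range.1 hj, heq⟩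

end Interval

section Shifts

open Polynomial

variable {p : ℕ} [hp : Fact p.Prime]

/-- A nontrivial combination of fewer than `deg f` translates of `f` has degree at least two. -/
lemma natDegree_sum_taylor_add_pos (f : (ZMod p)[X]) (hD : 2 ≤ f.natDegree)
    (hDp : f.natDegree < p) {k : ℕ} (hk : k ≤ f.natDegree - 1) {d a : Fin k → ZMod p}
    (hd : Function.Injective d) (ha : a ≠ 0) (b : ZMod p) :
    0 < (∑ i, C (a i) * taylor (d i) f + C b * X).natDegree := by
  by_contra! hQ
  set D := f.natDegree with hDdef
  have hcoeff : ∀ m, 2 ≤ m → ∑ i, a i * (hasseDeriv m f).eval (d i) = 0 := by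
    intro m hm
    have h := coeff_eq_zero_of_natDegree_lt (lt_of_le_of_lt hQ (by omega : 0 < m))
    rw [coeff_add, finsetSum_coeff, coeff_C_mul, coeff_X_of_ne_one (by omega), mul_zero,
      add_zero] at h
    simpa only [coeff_C_mul, taylor_coeff] using h
  have hmom : ∀ j, j ≤ D - 2 → ∑ i, a i * d i ^ j = 0 := by
    intro j
    induction j using Nat.strong_induction_on with
    | _ j ih =>
      intro hj
      have h := hcoeff (D - j) (by omega)
      have hdeg : (hasseDeriv (D - j) f).natDegree < j + 1 :=
        (natDegree_hasseDeriv_le f (D - j)).trans_lt (by omega)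
      simp_rw [eval_eq_sum_range' hdeg, mul_sum] at h
      rw [sum_comm, sum_range_succ, sum_eq_zero, zero_add] at h
      · simp_rw [mul_left_comm (a _), ← mul_sum] at h
        refine (mul_eq_zero.1 h).resolve_left ?_
        rw [hasseDeriv_coeff, Nat.add_sub_cancel' (by omega)]
        refine mul_ne_zero ?_ (leadingCoeff_ne_zero.2 (by rintro rfl; simp [hDdef] at hD))
        rw [Ne, ZMod.natCast_eq_zero_iff]
        intro hdvd
        have h2 := dvd_mul_of_dvd_left (dvd_mul_of_dvd_left hdvd (D - j).factorial)
          (D - (D - j)).factorial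
        rw [Nat.choose_mul_factorial_mul_factorial (Nat.sub_le D j), hp.out.dvd_factorial] at h2
        omega
      · intro l hl
        simp_rw [mul_left_comm (a _), ← mul_sum]
        rw [ih l (mem_range.1 hl) (by have := mem_range.1 hl; omega), mul_zero]
  exact ha (Matrix.eq_zero_of_forall_pow_sum_mul_pow_eq_zero hd fun i => hmom i (by omega))

/-- Weil's bound for the polynomials that occur in correlation sums. -/
lemma norm_sum_stdAddChar_shifts_le (f : (ZMod p)[X]) (hD : 2 ≤ f.natDegree)
    (hDp : f.natDegree < p) {k : ℕ} (hk : k ≤ f.natDegree - 1) {d a : Fin k → ZMod p}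
    (hd : Function.Injective d) (ha : a ≠ 0) (b : ZMod p) :
    ‖∑ x : ZMod p, ZMod.stdAddChar (∑ i, a i * f.eval (x + d i) + b * x)‖ ≤
      f.natDegree * √p := by
  set Q := ∑ i, C (a i) * taylor (d i) f + C b * X with hQ
  have hpos := natDegree_sum_taylor_add_pos f hD hDp hk hd ha b
  rw [← hQ] at hpos
  have hle : Q.natDegree ≤ f.natDegree := by
    refine natDegree_add_le_of_degree_le (natDegree_sum_le_of_forall_le _ _ fun i _ => ?_) ?_
    · exact (natDegree_C_mul_le _ _).trans (natDegree_taylor f (d i)).le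
    · exact (natDegree_C_mul_le _ _).trans (natDegree_X_le.trans (by omega))
  have hcop : p.Coprime Q.natDegree :=
    (Nat.coprime_of_lt_prime hpos.ne' (hle.trans_lt hDp) hp.out)
  have hψ : (ZMod.stdAddChar : AddChar (ZMod p) ℂ) ≠ 1 := by
    intro h
    have h1 : ZMod.stdAddChar (N := p) 1 = ZMod.stdAddChar (N := p) 0 := by rw [h]; simp
    exact one_ne_zero (ZMod.injective_stdAddChar h1)
  have h := norm_sum_addChar_eval_le Q hpos hcop hψ
  have hev : ∀ x, Q.eval x = ∑ i, a i * f.eval (x + d i) + b * x := by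
    intro x
    simp [hQ, eval_finsetSum, taylor_eval]
  simp_rw [hev] at h
  refine h.trans ?_
  gcongr
  omega

end Shifts

section Correlation

lemma addChar_sum_eq_prod {A M ι : Type*} [AddCommMonoid A] [CommMonoid M] (ψ : AddChar A M)
    (t : Finset ι) (g : ι → A) : ψ (∑ i ∈ t, g i) = ∏ i ∈ t, ψ (g i) :=
  map_prod ψ.toMonoidHom (fun i => Multiplicative.ofAdd (g i)) t


open Polynomial

variable {p : ℕ} [hp : Fact p.Prime]

lemma sum_range_natCast_eq_sum_ite {M : ℕ} (hM : M ≤ p) (g : ZMod p → ℂ) :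
    ∑ n ∈ range M, g n =
      ∑ x, (if ∃ j < M, x = (((0 : ℤ) + j : ℤ) : ZMod p) then 1 else 0) * g x := by
  simp_rw [ite_mul, one_mul, zero_mul]
  rw [← sum_filter]
  refine sum_bij (fun n _ => (n : ZMod p)) ?_ ?_ ?_ fun _ _ => rfl
  · intro n hn
    exact mem_filter.2 ⟨mem_univ _, n, mem_range.1 hn, by simp⟩
  · intro m hm n hn h
    have h1 := (ZMod.natCast_eq_natCast_iff' m n p).1 h
    rwa [Nat.mod_eq_of_lt ((mem_range.1 hm).trans_le hM),
      Nat.mod_eq_of_lt ((mem_range.1 hn).trans_le hM)] at h1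
  · intro x hx
    obtain ⟨-, n, hn, rfl⟩ := mem_filter.1 hx
    exact ⟨n, mem_range.2 hn, by simp⟩

/-- Weil's bound for incomplete sums. -/
lemma norm_sum_range_stdAddChar_le (f : (ZMod p)[X]) (hD : 2 ≤ f.natDegree)
    (hDp : f.natDegree < p) {k : ℕ} (hk : k ≤ f.natDegree - 1) {d a : Fin k → ZMod p}
    (hd : Function.Injective d) (ha : a ≠ 0) {M : ℕ} (hM : M ≤ p) :
    ‖∑ n ∈ range M, ZMod.stdAddChar (∑ i, a i * f.eval ((n : ZMod p) + d i))‖ ≤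
      (1 + (0.85 * Real.log p + 2.85)) * (f.natDegree * √p) := by
  obtain ⟨c, hc0, hc1, hc⟩ := exists_fourier_interval (p := p) 0 hM
  rw [sum_range_natCast_eq_sum_ite hM fun x => ZMod.stdAddChar (∑ i, a i * f.eval (x + d i))]
  simp_rw [← hc, sum_mul]
  rw [sum_comm]
  have hin : ∀ b, ∑ x, c b * ZMod.stdAddChar (b * x) *
      ZMod.stdAddChar (∑ i, a i * f.eval (x + d i)) =
      c b * ∑ x, ZMod.stdAddChar (∑ i, a i * f.eval (x + d i) + b * x) := by
    intro b
    rw [mul_sum]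
    refine Finset.sum_congr rfl fun x _ => ?_
    rw [mul_assoc, ← AddChar.map_add_eq_mul, add_comm]
  simp_rw [hin]
  have hc0' : ‖c 0‖ ≤ 1 := by
    rw [hc0, norm_div, Complex.norm_natCast, Complex.norm_natCast]
    exact div_le_one_of_le₀ (by exact_mod_cast hM) (by positivity)
  calc _ ≤ ∑ b, ‖c b‖ * (f.natDegree * √p) := by
        refine (norm_sum_le _ _).trans (sum_le_sum fun b _ => ?_)
        rw [norm_mul]
        gcongr
        exact norm_sum_stdAddChar_shifts_le f hD hDp hk hd ha b
    _ = (‖c 0‖ + ∑ b ∈ univ.erase 0, ‖c b‖) * (f.natDegree * √p) := by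
        rw [← sum_mul, add_sum_erase univ (fun b => ‖c b‖) (mem_univ 0)]
    _ ≤ _ := by gcongr

open scoped Classical in
/-- The residues `n` at which `f` takes a value in `{r, …, r + s - 1}` modulo `p`. -/
noncomputable def valueSet (f : (ZMod p)[X]) (r : ℤ) (s : ℕ) : Finset ℕ :=
  (range p).filter fun n => ∃ h : ℤ, r ≤ h ∧ h < r + s ∧ f.eval (n : ZMod p) = (h : ZMod p)

lemma lt_of_mem_valueSet {f : (ZMod p)[X]} {r : ℤ} {s n : ℕ} (hn : n ∈ valueSet f r s) :
    n < p := by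
  simp only [valueSet, mem_filter, mem_range] at hn
  exact hn.1

lemma mod_mem_valueSet {f : (ZMod p)[X]} {r : ℤ} {s n : ℕ} :
    n % p ∈ valueSet f r s ↔ ∃ j < s, f.eval (n : ZMod p) = ((r + j : ℤ) : ZMod p) := by
  simp only [valueSet, mem_filter, mem_range, Nat.mod_lt _ hp.out.pos, true_and, ZMod.natCast_mod]
  constructor
  · rintro ⟨h, h1, h2, h3⟩
    refine ⟨(h - r).toNat, by omega, ?_⟩
    rw [h3, Int.toNat_of_nonneg (by omega), add_sub_cancel]
  · rintro ⟨j, h1, h2⟩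
    exact ⟨r + j, by omega, by omega, h2⟩

lemma card_valueSet_eq (f : (ZMod p)[X]) (r : ℤ) (s : ℕ) :
    ((valueSet f r s).card : ℂ) =
      ∑ x, if ∃ j < s, f.eval x = ((r + j : ℤ) : ZMod p) then 1 else 0 := by
  rw [← sum_filter, sum_const, nsmul_eq_mul, mul_one, Nat.cast_inj]
  refine card_bij (fun n _ => (n : ZMod p)) ?_ ?_ ?_
  · intro n hn
    have hn' : n < p := lt_of_mem_valueSet hn
    rw [← Nat.mod_eq_of_lt hn', mod_mem_valueSet] at hn
    exact mem_filter.2 ⟨mem_univ _, hn⟩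
  · intro m hm n hn h
    have hn' : n < p := lt_of_mem_valueSet hn
    have hm' : m < p := lt_of_mem_valueSet hm
    have h1 := (ZMod.natCast_eq_natCast_iff' m n p).1 h
    rwa [Nat.mod_eq_of_lt hn', Nat.mod_eq_of_lt hm'] at h1
  · intro x hx
    have hx' : ((x.val : ℕ) : ZMod p) = x := by simp
    refine ⟨x.val, ?_, hx'⟩
    rw [← Nat.mod_eq_of_lt (ZMod.val_lt x), mod_mem_valueSet, hx']
    exact (mem_filter.1 hx).2

lemma card_valueSet_le (f : (ZMod p)[X]) (r : ℤ) (s : ℕ) : (valueSet f r s).card ≤ p := by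
  simpa using card_le_card (t := range p) fun n hn => mem_range.2 (lt_of_mem_valueSet hn)

/-- The discrepancy estimate for the values of `f`. -/
lemma abs_card_valueSet_sub_le (f : (ZMod p)[X]) (hD : 2 ≤ f.natDegree) (hDp : f.natDegree < p)
    (r : ℤ) {s : ℕ} (hs : s ≤ p) :
    |((valueSet f r s).card : ℝ) - s| ≤ (0.85 * Real.log p + 2.85) * (f.natDegree * √p) := by
  obtain ⟨c, hc0, hc1, hc⟩ := exists_fourier_interval r hs
  have hpC : (p : ℂ) ≠ 0 := by exact_mod_cast hp.out.ne_zero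
  have key : ((valueSet f r s).card : ℂ) - s =
      ∑ a ∈ univ.erase 0, c a * ∑ x, ZMod.stdAddChar (a * f.eval x) := by
    rw [card_valueSet_eq]
    simp_rw [← hc]
    rw [sum_comm]
    simp_rw [← mul_sum]
    rw [← add_sum_erase _ _ (mem_univ (0 : ZMod p)), hc0]
    simp [hpC]
  have hnorm : |((valueSet f r s).card : ℝ) - s| = ‖((valueSet f r s).card : ℂ) - s‖ := by
    rw [← Real.norm_eq_abs, ← Complex.norm_real]
    push_cast
    rfl
  rw [hnorm, key]
  calc _ ≤ ∑ a ∈ univ.erase 0, ‖c a‖ * (f.natDegree * √p) := by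
        refine (norm_sum_le _ _).trans (sum_le_sum fun a ha => ?_)
        rw [norm_mul]
        gcongr
        have := norm_sum_stdAddChar_shifts_le f hD hDp (k := 1) (by omega) (d := 0)
          (a := fun _ => a) (Function.injective_of_subsingleton _)
          (fun h => (mem_erase.1 ha).1 (congrFun h 0)) 0
        simpa using this
    _ ≤ _ := by
        rw [← sum_mul]
        gcongr

lemma abs_fsub_le_one {q : ℕ} {R : Finset ℕ} (hR : R.card ≤ q) (n : ℕ) : |fsub q R n| ≤ 1 := by
  have h0 : (0 : ℝ) ≤ R.card / q := by positivity
  have h1 : (R.card : ℝ) / q ≤ 1 :=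
    div_le_one_of_le₀ (by exact_mod_cast hR) (by positivity)
  rw [fsub, abs_le]
  split_ifs <;> constructor <;> linarith

lemma abs_sum_prod_fsub_le_card {q k M : ℕ} {R : Finset ℕ} (hR : R.card ≤ q) (hM : M ≤ q)
    (d : Fin k → ℕ) : |∑ n ∈ range M, ∏ i, fsub q R (n + d i)| ≤ q := by
  calc _ ≤ ∑ n ∈ range M, |∏ i, fsub q R (n + d i)| := abs_sum_le_sum_abs _ _
    _ ≤ ∑ n ∈ range M, (1 : ℝ) := by
        refine sum_le_sum fun n _ => ?_
        rw [abs_prod]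
        exact prod_le_one (fun _ _ => abs_nonneg _) fun i _ => abs_fsub_le_one hR _
    _ ≤ q := by simpa using (by exact_mod_cast hM : (M : ℝ) ≤ q)

lemma exists_fourier_fsub_valueSet (f : (ZMod p)[X]) (r : ℤ) {s : ℕ} (hs : s ≤ p) :
    ∃ γ : ZMod p → ℂ, ‖γ 0‖ = |((valueSet f r s).card : ℝ) - s| / p ∧
      ∑ a ∈ univ.erase 0, ‖γ a‖ ≤ 0.85 * Real.log p + 2.85 ∧
      ∀ n : ℕ, (fsub p (valueSet f r s) n : ℂ) =
        ∑ a, γ a * ZMod.stdAddChar (a * f.eval (n : ZMod p)) := by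
  obtain ⟨c, hc0, hc1, hc⟩ := exists_fourier_interval r hs
  refine ⟨fun a => c a - if a = 0 then ((valueSet f r s).card : ℂ) / p else 0, ?_, ?_, ?_⟩
  · beta_reduce
    rw [if_pos rfl, hc0, ← sub_div, norm_div, norm_sub_rev, Complex.norm_natCast,
      ← Real.norm_eq_abs, ← Complex.norm_real]
    push_cast
    rfl
  · refine le_trans (le_of_eq ?_) hc1
    refine Finset.sum_congr rfl fun a ha => ?_
    beta_reduce
    rw [if_neg (mem_erase.1 ha).1, sub_zero]
  · intro n
    simp_rw [sub_mul, sum_sub_distrib, hc, ite_mul, zero_mul]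
    rw [sum_ite_eq' univ (0 : ZMod p), if_pos (mem_univ _), zero_mul, AddChar.map_zero_eq_one,
      mul_one, fsub]
    by_cases h : ∃ j < s, f.eval (n : ZMod p) = ((r + j : ℤ) : ZMod p)
    · rw [if_pos (mod_mem_valueSet.2 h), if_pos h]
      push_cast
      rfl
    · rw [if_neg fun h' => h (mod_mem_valueSet.1 h'), if_neg h]
      push_cast
      ring

/-- The correlation sums, in terms of the discrepancy of the values of `f`. -/
lemma abs_sum_prod_fsub_valueSet_le (f : (ZMod p)[X]) (hD : 2 ≤ f.natDegree)
    (hDp : f.natDegree < p) (r : ℤ) {s : ℕ} (hs : s ≤ p) {k : ℕ} (hk : k ≤ f.natDegree - 1)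
    {d : Fin k → ℕ} (hd : StrictMono d) (hdp : ∀ i, d i ≤ p - 1) {M : ℕ} (hM : M ≤ p) :
    |∑ n ∈ range M, ∏ i, fsub p (valueSet f r s) (n + d i)| ≤
      p * (|((valueSet f r s).card : ℝ) - s| / p) ^ k +
      (|((valueSet f r s).card : ℝ) - s| / p + (0.85 * Real.log p + 2.85)) ^ k *
        ((1 + (0.85 * Real.log p + 2.85)) * (f.natDegree * √p)) := by
  obtain ⟨γ, hγ0, hγ1, hγ⟩ := exists_fourier_fsub_valueSet f r hs
  have hinj : Function.Injective fun i => (d i : ZMod p) := by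
    intro i j hij
    have h1 := (ZMod.natCast_eq_natCast_iff' _ _ p).1 hij
    have hi := hdp i
    have hj := hdp j
    have hpos := hp.out.pos
    rw [Nat.mod_eq_of_lt (by omega), Nat.mod_eq_of_lt (by omega)] at h1
    exact hd.injective h1
  have hnn : 0 ≤ (1 + (0.85 * Real.log p + 2.85)) * (f.natDegree * √p) := by
    have := Real.log_natCast_nonneg p
    positivity
  have hexp : ((∑ n ∈ range M, ∏ i, fsub p (valueSet f r s) (n + d i) : ℝ) : ℂ) =
      ∑ a : Fin k → ZMod p, (∏ i, γ (a i)) *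
        ∑ n ∈ range M, ZMod.stdAddChar (∑ i, a i * f.eval ((n : ZMod p) + d i)) := by
    push_cast
    simp_rw [hγ, prod_univ_sum, Fintype.piFinset_univ, prod_mul_distrib, mul_sum]
    rw [sum_comm]
    refine Finset.sum_congr rfl fun a _ => Finset.sum_congr rfl fun n _ => ?_
    rw [addChar_sum_eq_prod]
    push_cast
    rfl
  rw [← Real.norm_eq_abs, ← Complex.norm_real, hexp, ← add_sum_erase _ _ (mem_univ 0), ← hγ0]
  refine (norm_add_le _ _).trans (add_le_add ?_ ?_)
  · rw [norm_mul, norm_prod, mul_comm]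
    simp only [Pi.zero_apply, zero_mul, sum_const_zero, AddChar.map_zero_eq_one, sum_const,
      card_range, nsmul_eq_mul, mul_one, prod_const, card_univ, Fintype.card_fin,
      Complex.norm_natCast]
    gcongr
  · calc _ ≤ ∑ a ∈ univ.erase (0 : Fin k → ZMod p), (∏ i, ‖γ (a i)‖) *
          ((1 + (0.85 * Real.log p + 2.85)) * (f.natDegree * √p)) := by
          refine (norm_sum_le _ _).trans (sum_le_sum fun a ha => ?_)
          rw [norm_mul, norm_prod]
          gcongr
          exact norm_sum_range_stdAddChar_le f hD hDp hk hinj (mem_erase.1 ha).1 hM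
      _ ≤ ∑ a : Fin k → ZMod p, (∏ i, ‖γ (a i)‖) *
          ((1 + (0.85 * Real.log p + 2.85)) * (f.natDegree * √p)) :=
          sum_le_sum_of_subset_of_nonneg (erase_subset _ _) fun _ _ _ => by positivity
      _ = (∑ a, ‖γ a‖) ^ k * ((1 + (0.85 * Real.log p + 2.85)) * (f.natDegree * √p)) := by
          rw [← sum_mul, ← Fintype.piFinset_univ,
            ← prod_univ_sum (fun _ : Fin k => univ) fun _ b => ‖γ b‖]
          simp
      _ ≤ _ := by
          rw [← add_sum_erase univ (fun b => ‖γ b‖) (mem_univ 0)]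
          gcongr

end Correlation

section Final

lemma le_exp_mul_of_log_lt {n : ℕ} (hn : 0 < n) {D : ℝ} (hD : 2 ≤ D)
    (h : Real.log n < 57 ∨ √n < 10 * D) : (n : ℝ) ≤ Real.exp 57 * D * √n := by
  have hn' : (0 : ℝ) < n := by exact_mod_cast hn
  have he : (10 : ℝ) ≤ Real.exp 57 := by linarith [Real.add_one_le_exp (57 : ℝ)]
  have hsq : √(n : ℝ) ≤ Real.exp 57 * D := by
    rcases h with h | h
    · have h1 : (n : ℝ) ≤ Real.exp 57 := (Real.log_le_iff_le_exp hn').1 h.le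
      have h2 : (1 : ℝ) ≤ n := by exact_mod_cast hn
      have h3 : √(n : ℝ) ≤ n := Real.sqrt_le_iff.2 ⟨hn'.le, by nlinarith⟩
      nlinarith
    · nlinarith
  calc (n : ℝ) = √n * √n := (Real.mul_self_sqrt hn'.le).symm
    _ ≤ _ := by gcongr

lemma correlation_arith {n D L Δ : ℝ} {k : ℕ} (hk : 0 < k) (hn : 0 < n) (hL : 57 ≤ L)
    (hD : 0 ≤ D) (hDn : 10 * D ≤ √n) (hΔ0 : 0 ≤ Δ) (hΔn : Δ ≤ n)
    (hΔ : Δ ≤ (0.85 * L + 2.85) * (D * √n)) :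
    n * (Δ / n) ^ k + (Δ / n + (0.85 * L + 2.85)) ^ k * ((1 + (0.85 * L + 2.85)) * (D * √n)) ≤
      3 * (D * √n) * L ^ (k + 1) := by
  have hX : 0 ≤ D * √n := by positivity
  have hXn : D * √n ≤ n / 10 := by
    nlinarith [Real.mul_self_sqrt hn.le, Real.sqrt_nonneg n]
  have hE : 0.85 * L + 2.85 ≤ 0.9 * L := by linarith
  have hΔL : Δ ≤ 0.9 * L * (D * √n) := hΔ.trans (by gcongr)
  have hq : Δ / n ≤ 0.09 * L := by
    rw [div_le_iff₀ hn]
    nlinarith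
  have hq0 : 0 ≤ Δ / n := by positivity
  have hpow : (Δ / n + (0.85 * L + 2.85)) ^ k ≤ L ^ k :=
    pow_le_pow_left₀ (by positivity) (by linarith) k
  have hLk : 1 ≤ L ^ k := one_le_pow₀ (by linarith)
  have h1 : n * (Δ / n) ^ k ≤ D * √n * L ^ (k + 1) := by
    calc n * (Δ / n) ^ k ≤ n * (Δ / n) := by
          gcongr
          exact pow_le_of_le_one hq0 (div_le_one_of_le₀ hΔn hn.le) hk.ne'
      _ = Δ := by field_simp
      _ ≤ (D * √n) * (1 * L) := by nlinarith
      _ ≤ (D * √n) * (L ^ k * L) := by gcongr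
      _ = _ := by ring
  have h2 : (Δ / n + (0.85 * L + 2.85)) ^ k * ((1 + (0.85 * L + 2.85)) * (D * √n)) ≤
      2 * (D * √n) * L ^ (k + 1) := by
    calc _ ≤ L ^ k * ((2 * L) * (D * √n)) := by
          gcongr
          linarith
      _ = _ := by ring
  linarith

end Final

open Polynomial in
theorem card_valueSet_and_corrK_le {p : ℕ} [hp : Fact p.Prime] (hodd : Odd p) (f : (ZMod p)[X])
    (hD : 2 ≤ f.natDegree) (r : ℤ) {s : ℕ} (hs : s ≤ p) :
    |((valueSet f r s).card : ℝ) - s| ≤ Real.exp 57 * f.natDegree * √p * Real.log p ∧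
      ∀ k : ℕ, 0 < k → k ≤ f.natDegree - 1 →
        corrK (valueSet f r s) p k ≤
          Real.exp 57 * f.natDegree * √p * Real.log p ^ (k + 1) := by
  have hp3 : 3 ≤ p := by
    have h2 := hp.out.two_le
    rcases hodd with ⟨m, hm⟩
    omega
  have hp0 : (0 : ℝ) < p := by exact_mod_cast hp.out.pos
  have hL1 : 1 ≤ Real.log p := by
    rw [Real.le_log_iff_exp_le hp0]
    have : (3 : ℝ) ≤ p := by exact_mod_cast hp3
    linarith [Real.exp_one_lt_d9]
  have hD' : (2 : ℝ) ≤ f.natDegree := by exact_mod_cast hD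
  have hcard : ((valueSet f r s).card : ℝ) ≤ p := by exact_mod_cast card_valueSet_le f r s
  have hs' : (s : ℝ) ≤ p := by exact_mod_cast hs
  have hΔp : |((valueSet f r s).card : ℝ) - s| ≤ p := by
    rw [abs_le]
    constructor <;> linarith [Nat.cast_nonneg (α := ℝ) s,
      Nat.cast_nonneg (α := ℝ) (valueSet f r s).card]
  by_cases h : Real.log p < 57 ∨ √(p : ℝ) < 10 * f.natDegree
  · have hb := le_exp_mul_of_log_lt hp.out.pos hD' h
    have hb0 : 0 ≤ Real.exp 57 * f.natDegree * √p := by positivity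
    refine ⟨hΔp.trans (hb.trans (le_mul_of_one_le_right hb0 hL1)), fun k _ _ => ?_⟩
    have hLk : 1 ≤ Real.log p ^ (k + 1) := one_le_pow₀ hL1
    refine Real.sSup_le ?_ (by positivity)
    rintro x ⟨M, d, -, hM, -, -, rfl⟩
    exact (abs_sum_prod_fsub_le_card (card_valueSet_le f r s) hM d).trans
      (hb.trans (le_mul_of_one_le_right hb0 hLk))
  · push Not at h
    obtain ⟨hL, hDp⟩ := h
    have hlt : f.natDegree < p := by
      have hp1 : (1 : ℝ) ≤ p := by exact_mod_cast hp.out.one_lt.le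
      have h1 : √(p : ℝ) ≤ p := Real.sqrt_le_iff.2 ⟨hp0.le, by nlinarith⟩
      have : (f.natDegree : ℝ) < p := by linarith
      exact_mod_cast this
    have hΔ := abs_card_valueSet_sub_le f hD hlt r hs
    have he : (3 : ℝ) ≤ Real.exp 57 := by linarith [Real.add_one_le_exp (57 : ℝ)]
    constructor
    · calc _ ≤ (0.85 * Real.log p + 2.85) * (f.natDegree * √p) := hΔ
        _ ≤ (Real.exp 57 * Real.log p) * (f.natDegree * √p) := by
          gcongr
          nlinarith
        _ = _ := by ring
    · intro k hk0 hk
      refine Real.sSup_le ?_ (by positivity)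
      rintro x ⟨M, d, -, hM, hd, hdp, rfl⟩
      calc _ ≤ _ := abs_sum_prod_fsub_valueSet_le f hD hlt r hs hk hd hdp hM
        _ ≤ 3 * (f.natDegree * √p) * Real.log p ^ (k + 1) :=
          correlation_arith hk0 hp0 hL (by positivity) hDp (abs_nonneg _) hΔp hΔ
        _ ≤ Real.exp 57 * (f.natDegree * √p) * Real.log p ^ (k + 1) := by gcongr
        _ = _ := by ring

open scoped Classical in
theorem statement16 :
    ∃ c > (0 : ℝ), ∀ p : ℕ, p.Prime → Odd p →
      ∀ f : Polynomial (ZMod p), 2 ≤ f.natDegree →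
      ∀ r : ℤ, ∀ s : ℕ, 0 < s → s < p →
      (|(((Finset.range p).filter
            (fun n => ∃ h : ℤ, r ≤ h ∧ h < r + s ∧
              f.eval (n : ZMod p) = (h : ZMod p))).card : ℝ) - s| ≤
          c * f.natDegree * Real.sqrt p * Real.log p) ∧
      (∀ k : ℕ, 0 < k → k ≤ f.natDegree - 1 →
        corrK ((Finset.range p).filter
            (fun n => ∃ h : ℤ, r ≤ h ∧ h < r + s ∧
              f.eval (n : ZMod p) = (h : ZMod p))) p k ≤
          c * f.natDegree * Real.sqrt p * Real.log p ^ (k + 1)) := by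
  refine ⟨Real.exp 57, Real.exp_pos _, fun p hp hodd f hD r s _ hs => ?_⟩
  have : Fact p.Prime := ⟨hp⟩
  have h := card_valueSet_and_corrK_le hodd f hD r hs.le
  refine ⟨?_, h.2⟩
  -- In the frozen statement the first set is read, through the monad structure of `Finset`,
  -- as a set of residue classes.
  convert h.1 using 4
  simp only [Finset.bind_def, Finset.pure_def]
  symm
  refine card_bij (fun (n : ℕ) _ => (n : ZMod p)) ?_ ?_ ?_
  · intro n hn
    simp only [valueSet, mem_filter] at hn
    refine mem_filter.2 ⟨?_, hn.2⟩
    rw [@Finset.mem_sup _ _ (_)]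
    exact ⟨n, hn.1, mem_singleton_self _⟩
  · intro m hm n hn hmn
    have h1 := (ZMod.natCast_eq_natCast_iff' m n p).1 hmn
    rwa [Nat.mod_eq_of_lt (lt_of_mem_valueSet hm), Nat.mod_eq_of_lt (lt_of_mem_valueSet hn)] at h1
  · intro x hx
    obtain ⟨hx, hx'⟩ := mem_filter.1 hx
    rw [@Finset.mem_sup _ _ (_)] at hx
    obtain ⟨n, hn, hxn⟩ := hx
    obtain rfl := mem_singleton.1 hxn
    refine ⟨n, ?_, rfl⟩
    simp only [valueSet, mem_filter]
    exact ⟨hn, hx'⟩
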